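/- arXiv:1506.03016 — 5 statements merged into one kernel-verified Lean document; each statement's English description precedes it below -/
import Mathlib

section
/- Suppose each f_i is convex and L-smooth, and let x* be a minimizer of f. Then for all x, x̃ ∈ ℝ^d, (1/n)·Σ_{j=1}^n ‖∇f_j(x) − ∇f_j(x̃) + ∇f(x̃) − ∇f(x)‖² ≤ 4L·( f(x) − f(x*) + f(x̃) − f(x*) ). -/
open RealInnerProductSpace

section Helpers

variable {E : Type*} [NormedAddCommGroup E] [InnerProductSpace ℝ E] [CompleteSpace E]

lemma svrg_hasDerivAt_line (f : E → ℝ) (g : E → E) (hg : ∀ x, HasGradientAt f (g x) x)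
    (x v : E) (t : ℝ) :
    HasDerivAt (fun t : ℝ => f (x + t • v)) (inner ℝ (g (x + t • v)) v) t := by
  have h1 : HasDerivAt (fun t : ℝ => x + t • v) v t := by
    simpa using ((hasDerivAt_id t).smul_const v).const_add x
  have h2 := (hg (x + t • v)).hasFDerivAt.comp_hasDerivAt t h1
  rw [InnerProductSpace.toDual_apply_apply] at h2
  exact h2

lemma svrg_descent (f : E → ℝ) (g : E → E) (hg : ∀ x, HasGradientAt f (g x) x) (L : ℝ)
    (hs : ∀ x y, ‖g x - g y‖ ≤ L * ‖x - y‖) (x v : E) :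
    f (x + v) ≤ f x + inner ℝ (g x) v + L / 2 * ‖v‖ ^ 2 := by
  have hd : ∀ t : ℝ, HasDerivAt
      (fun t : ℝ => f (x + t • v) - t * inner ℝ (g x) v - L / 2 * ‖v‖ ^ 2 * t ^ 2)
      (inner ℝ (g (x + t • v)) v - 1 * inner ℝ (g x) v
        - L / 2 * ‖v‖ ^ 2 * ((2 : ℕ) * t ^ (2 - 1))) t := fun t =>
    ((svrg_hasDerivAt_line f g hg x v t).sub ((hasDerivAt_id t).mul_const _)).sub
      ((hasDerivAt_pow 2 t).const_mul _)
  have ha := antitoneOn_of_deriv_nonpos (convex_Icc (0 : ℝ) 1)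
    (fun t _ => (hd t).continuousAt.continuousWithinAt)
    (fun t _ => (hd t).differentiableAt.differentiableWithinAt)
    (fun t ht => by
      rw [interior_Icc] at ht
      rw [(hd t).deriv]
      have h1 : inner ℝ (g (x + t • v) - g x) v ≤ ‖g (x + t • v) - g x‖ * ‖v‖ :=
        real_inner_le_norm _ _
      have h2 := hs (x + t • v) x
      rw [add_sub_cancel_left, norm_smul, Real.norm_of_nonneg ht.1.le] at h2
      have h3 := mul_le_mul_of_nonneg_right h2 (norm_nonneg v)
      rw [inner_sub_left] at h1
      norm_num
      nlinarith)
  have := ha (Set.left_mem_Icc.2 zero_le_one) (Set.right_mem_Icc.2 zero_le_one) zero_le_one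
  simp at this
  linarith

lemma svrg_first_order (f : E → ℝ) (g : E → E) (hg : ∀ x, HasGradientAt f (g x) x)
    (hc : ConvexOn ℝ Set.univ f) (x v : E) :
    f x + inner ℝ (g x) v ≤ f (x + v) := by
  have hc' : ConvexOn ℝ Set.univ (fun t : ℝ => f (x + t • v)) := by
    refine ⟨convex_univ, fun a _ b _ p q hp hq hpq => ?_⟩
    have := hc.2 (Set.mem_univ (x + a • v)) (Set.mem_univ (x + b • v)) hp hq hpq
    have e : p • (x + a • v) + q • (x + b • v) = x + (p • a + q • b) • v := by
      have : x = (p + q) • x := by rw [hpq, one_smul]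
      conv_rhs => rw [this]
      simp only [smul_eq_mul]
      module
    rw [e] at this
    exact this
  have h := hc'.le_slope_of_hasDerivAt (Set.mem_univ 0) (Set.mem_univ 1) zero_lt_one
    (svrg_hasDerivAt_line f g hg x v 0)
  simp [slope_def_field] at h
  linarith

lemma svrg_coco (f : E → ℝ) (g : E → E) (hg : ∀ x, HasGradientAt f (g x) x) (L : ℝ) (hL : 0 < L)
    (hc : ConvexOn ℝ Set.univ f)
    (hs : ∀ x y, ‖g x - g y‖ ≤ L * ‖x - y‖) (x s : E) :
    ‖g x - g s‖ ^ 2 ≤ 2 * L * (f x - f s - inner ℝ (g s) (x - s)) := by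
  have h1 := svrg_descent f g hg L hs x (-(L⁻¹ • (g x - g s)))
  have h2 := svrg_first_order f g hg hc s ((x - s) + -(L⁻¹ • (g x - g s)))
  have e : s + ((x - s) + -(L⁻¹ • (g x - g s))) = x + -(L⁻¹ • (g x - g s)) := by abel
  rw [e, inner_add_right, inner_neg_right, inner_smul_right] at h2
  rw [norm_neg, norm_smul, inner_neg_right, inner_smul_right, mul_pow, Real.norm_eq_abs,
    sq_abs] at h1
  have h3 : inner ℝ (g x) (g x - g s) - inner ℝ (g s) (g x - g s) = ‖g x - g s‖ ^ 2 := by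
    rw [← inner_sub_left, real_inner_self_eq_norm_sq]
  have h4 : L⁻¹ * ‖g x - g s‖ ^ 2 - L / 2 * (L⁻¹ ^ 2 * ‖g x - g s‖ ^ 2)
      ≤ f x - f s - inner ℝ (g s) (x - s) := by
    rw [← h3] at h1 ⊢
    linarith
  have h5 : L⁻¹ * ‖g x - g s‖ ^ 2 - L / 2 * (L⁻¹ ^ 2 * ‖g x - g s‖ ^ 2)
      = ‖g x - g s‖ ^ 2 / (2 * L) := by
    field_simp
    ring
  rw [h5, div_le_iff₀ (by positivity)] at h4
  linarith

lemma svrg_variance (n : ℕ) (hn : 1 ≤ n) (a : Fin n → E) :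
    ∑ j, ‖a j - (n : ℝ)⁻¹ • ∑ i, a i‖ ^ 2 ≤ ∑ j, ‖a j‖ ^ 2 := by
  have hn' : (0 : ℝ) < n := by exact_mod_cast hn
  set m := (n : ℝ)⁻¹ • ∑ i, a i with hm
  have hsum : ∑ i, a i = (n : ℝ) • m := by rw [hm, smul_inv_smul₀ hn'.ne']
  simp only [norm_sub_sq_real, Finset.sum_add_distrib, Finset.sum_sub_distrib,
    ← Finset.mul_sum, ← sum_inner]
  rw [hsum, real_inner_smul_left, real_inner_self_eq_norm_sq]
  simp
  nlinarith [mul_nonneg hn'.le (sq_nonneg ‖m‖)]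

end Helpers

/-- **Componentwise variance bound (Corollary 3 of Xiao–Zhang).**
If each `f i : ℝ^d → ℝ` is convex and `L`-smooth, `f = (1/n) Σ f i`, and `x*` minimizes `f`,
then for all `x, x̃`,
`(1/n) Σ_j ‖∇f_j(x) − ∇f_j(x̃) + ∇f(x̃) − ∇f(x)‖² ≤ 4L (f(x) − f(x*) + f(x̃) − f(x*))`. -/
theorem svrg_component_variance_bound {dd : ℕ} (n : ℕ) (hn : 1 ≤ n) (L : ℝ) (hL : 0 < L)
    (f : Fin n → EuclideanSpace ℝ (Fin dd) → ℝ)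
    (f' : Fin n → EuclideanSpace ℝ (Fin dd) → EuclideanSpace ℝ (Fin dd))
    (hgrad : ∀ i x, HasGradientAt (f i) (f' i x) x)
    (hconv : ∀ i, ConvexOn ℝ Set.univ (f i))
    (hsmooth : ∀ i x y, ‖f' i x - f' i y‖ ≤ L * ‖x - y‖)
    (F : EuclideanSpace ℝ (Fin dd) → ℝ)
    (hF : F = fun x => (n : ℝ)⁻¹ * ∑ i, f i x)
    (Fg : EuclideanSpace ℝ (Fin dd) → EuclideanSpace ℝ (Fin dd))
    (hFg : Fg = fun x => (n : ℝ)⁻¹ • ∑ i, f' i x)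
    (xstar : EuclideanSpace ℝ (Fin dd)) (hmin : ∀ y, F xstar ≤ F y)
    (x xt : EuclideanSpace ℝ (Fin dd)) :
    (n : ℝ)⁻¹ * ∑ j, ‖f' j x - f' j xt + Fg xt - Fg x‖ ^ 2 ≤
      4 * L * (F x - F xstar + (F xt - F xstar)) := by
  have hn' : (0 : ℝ) < n := by exact_mod_cast hn
  have hzero : Fg xstar = 0 := by
    have hG : HasFDerivAt F (InnerProductSpace.toDual ℝ _ (Fg xstar)) xstar := by
      have h := (HasFDerivAt.fun_sum (u := Finset.univ)
        (fun i _ => (hgrad i xstar).hasFDerivAt)).const_mul (n : ℝ)⁻¹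
      rw [hF, hFg]
      simpa using h
    have h0 := IsLocalMin.hasFDerivAt_eq_zero (Filter.Eventually.of_forall hmin) hG
    simpa using h0
  have hsz : ∑ i, f' i xstar = 0 := by
    rw [hFg] at hzero
    exact (smul_eq_zero.1 hzero).resolve_left (inv_ne_zero hn'.ne')
  have hco : ∀ y, ∑ j, ‖f' j y - f' j xstar‖ ^ 2 ≤ 2 * L * (∑ j, f j y - ∑ j, f j xstar) := by
    intro y
    refine (Finset.sum_le_sum fun j _ =>
      svrg_coco (f j) (f' j) (hgrad j) L hL (hconv j) (hsmooth j) y xstar).trans_eq ?_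
    rw [← Finset.mul_sum, Finset.sum_sub_distrib, Finset.sum_sub_distrib, ← sum_inner, hsz,
      inner_zero_left, sub_zero]
  have hv := svrg_variance n hn (fun j => f' j x - f' j xt)
  have he : ∀ j, f' j x - f' j xt + Fg xt - Fg x
      = f' j x - f' j xt - (n : ℝ)⁻¹ • ∑ i, (f' i x - f' i xt) := by
    intro j
    rw [hFg, Finset.sum_sub_distrib, smul_sub]
    abel
  simp only [he]
  have hp : ∑ j, ‖f' j x - f' j xt‖ ^ 2
      ≤ 2 * ∑ j, ‖f' j x - f' j xstar‖ ^ 2 + 2 * ∑ j, ‖f' j xt - f' j xstar‖ ^ 2 := by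
    rw [Finset.mul_sum, Finset.mul_sum, ← Finset.sum_add_distrib]
    refine Finset.sum_le_sum fun j _ => ?_
    have h1 := parallelogram_law_with_norm ℝ (f' j x - f' j xstar) (f' j xt - f' j xstar)
    rw [sub_sub_sub_cancel_right] at h1
    nlinarith [mul_self_nonneg ‖f' j x - f' j xstar + (f' j xt - f' j xstar)‖]
  have hx := hco x
  have hxt := hco xt
  calc _ ≤ (n : ℝ)⁻¹ * (4 * L * ((∑ j, f j x - ∑ j, f j xstar)
        + (∑ j, f j xt - ∑ j, f j xstar))) :=
        mul_le_mul_of_nonneg_left (by linarith) (inv_nonneg.2 hn'.le)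
    _ = _ := by rw [hF]; ring
end

section
/- (Lemma 4, stochastic mirror descent step.) Let d : ℝ^d → ℝ be differentiable and 1-strongly convex with Bregman divergence V_x(y) = d(y) − d(x) − ⟨∇d(x), y − x⟩. Let α > 0, let z ∈ ℝ^d, let v_1, …, v_N ∈ ℝ^d be finitely many vectors with average g, and for each j let z_j ∈ ℝ^d satisfy ∇d(z_j) = ∇d(z) − α·v_j (the mirror descent update). Then for every u ∈ ℝ^d, α·⟨g, z − u⟩ ≤ V_z(u) − (1/N)·Σ_{j=1}^N V_{z_j}(u) + (1/2)·α²·‖g‖² + (1/2)·α²·(1/N)·Σ_{j=1}^N ‖v_j − g‖². -/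
open RealInnerProductSpace

/-- **Lemma 4 (stochastic mirror descent step).**
Let `d : ℝ^d → ℝ` be differentiable (with gradient `dg`) and `1`-strongly convex, with Bregman
divergence `V x y = d y − d x − ⟪dg x, y − x⟫`. Let `α > 0`, `z ∈ ℝ^d`, let `v 1, …, v N` have
average `g`, and let each `z j` satisfy the mirror descent update `dg (z j) = dg z − α • v j`.
Then for every `u`,
`α ⟪g, z − u⟫ ≤ V z u − (1/N) Σ_j V (z j) u + (1/2) α² ‖g‖² + (1/2) α² (1/N) Σ_j ‖v j − g‖²`. -/
theorem smd_step_bound {dd : ℕ}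
    (d : EuclideanSpace ℝ (Fin dd) → ℝ)
    (dg : EuclideanSpace ℝ (Fin dd) → EuclideanSpace ℝ (Fin dd))
    (hgrad : ∀ x, HasGradientAt d (dg x) x)
    (hsc : ∀ x y, d y ≥ d x + ⟪dg x, y - x⟫ + (1 / 2) * ‖y - x‖ ^ 2)
    (V : EuclideanSpace ℝ (Fin dd) → EuclideanSpace ℝ (Fin dd) → ℝ)
    (hV : ∀ x y, V x y = d y - d x - ⟪dg x, y - x⟫)
    (α : ℝ) (hα : 0 < α) (z : EuclideanSpace ℝ (Fin dd))
    (N : ℕ) (hN : 0 < N) (v : Fin N → EuclideanSpace ℝ (Fin dd))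
    (g : EuclideanSpace ℝ (Fin dd)) (hg : g = (N : ℝ)⁻¹ • ∑ j, v j)
    (zs : Fin N → EuclideanSpace ℝ (Fin dd))
    (hzs : ∀ j, dg (zs j) = dg z - α • v j)
    (u : EuclideanSpace ℝ (Fin dd)) :
    α * ⟪g, z - u⟫ ≤
      V z u - (N : ℝ)⁻¹ * ∑ j, V (zs j) u + (1 / 2) * α ^ 2 * ‖g‖ ^ 2 +
        (1 / 2) * α ^ 2 * ((N : ℝ)⁻¹ * ∑ j, ‖v j - g‖ ^ 2) := by
  have hN' : (N : ℝ) ≠ 0 := by exact_mod_cast hN.ne'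
  have hsum : ∑ j, v j = (N : ℝ) • g := by
    rw [hg, smul_smul, mul_inv_cancel₀ hN', one_smul]
  have key : ∀ j, α * ⟪v j, z - u⟫ - α ^ 2 * (⟪v j, g⟫ - ‖g‖ ^ 2) ≤
      V z u - V (zs j) u + (1 / 2) * α ^ 2 * ‖g‖ ^ 2 + (1 / 2) * α ^ 2 * ‖v j - g‖ ^ 2 := by
    intro j
    have h1 := hsc z (zs j)
    have h2 : 0 ≤ ‖(zs j - z) + α • v j‖ ^ 2 := by positivity
    rw [norm_add_sq_real, norm_smul, mul_pow, Real.norm_eq_abs, sq_abs, inner_smul_right,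
      real_inner_comm] at h2
    rw [hV, hV, hzs, norm_sub_sq_real]
    simp only [inner_sub_left, inner_sub_right, real_inner_smul_left] at h1 h2 ⊢
    linarith
  have hS := Finset.sum_le_sum (fun j (_ : j ∈ Finset.univ) => key j)
  simp only [Finset.sum_add_distrib, Finset.sum_sub_distrib, ← Finset.mul_sum, ← sum_inner,
    hsum, real_inner_smul_left, real_inner_self_eq_norm_sq, Finset.sum_const,
    Finset.card_univ, Fintype.card_fin, nsmul_eq_mul] at hS
  have hS2 := mul_le_mul_of_nonneg_left hS (show (0 : ℝ) ≤ (N : ℝ)⁻¹ by positivity)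
  refine le_trans (le_of_eq ?_) (hS2.trans (le_of_eq ?_))
  · field_simp
    ring
  · field_simp
end

section
/- (One-step key inequality of AMSVRG.) Suppose each f_i is convex and L-smooth, n ≥ 2, and x* is a minimizer of f. Let d : ℝ^d → ℝ be differentiable and 1-strongly convex with Bregman divergence V. Fix y_0, x, z ∈ ℝ^d, α > 0, batch size 1 ≤ b ≤ n, and set δ = (n−b)/(b(n−1)). For each size-b subset S of {1,…,n} define v_S = (1/b)·Σ_{i∈S}(∇f_i(x) − ∇f_i(y_0)) + ∇f(y_0), y_S = x − (1/L)·v_S, and let z_S satisfy ∇d(z_S) = ∇d(z) − α·v_S. Then, denoting by E_S the average over all size-b subsets, α·⟨∇f(x), z − x*⟩ ≤ V_z(x*) − E_S[V_{z_S}(x*)] + (1 + 4δ)·L·α²·( f(x) − f(x*) ) − L·α²·E_S[ f(y_S) − f(x*) ] + 4L·α²·δ·( f(y_0) − f(x*) ). -/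
open RealInnerProductSpace

section
variable {E : Type*} [NormedAddCommGroup E] [InnerProductSpace ℝ E] [CompleteSpace E]

theorem aux_line {f : E → ℝ} {f' : E → E} (hg : ∀ x, HasGradientAt f (f' x) x) (x y : E) (t : ℝ) :
    HasDerivAt (fun t : ℝ => f (x + t • (y - x))) ⟪f' (x + t • (y - x)), y - x⟫ t := by
  have h1 : HasDerivAt (fun t : ℝ => x + t • (y - x)) (y - x) t := by
    simpa using ((hasDerivAt_id t).smul_const (y - x)).const_add x
  have := (hg (x + t • (y - x))).hasFDerivAt.comp_hasDerivAt t h1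
  simp only [InnerProductSpace.toDual_apply_apply] at this
  exact this

theorem aux_convex {f : E → ℝ} {f' : E → E} (hg : ∀ x, HasGradientAt f (f' x) x)
    (hc : ConvexOn ℝ Set.univ f) (x y : E) : f x + ⟪f' x, y - x⟫ ≤ f y := by
  have hc1 : ConvexOn ℝ Set.univ (fun t : ℝ => f (x + t • (y - x))) := by
    have := hc.comp_affineMap (AffineMap.lineMap x y : ℝ →ᵃ[ℝ] E)
    refine this.congr ?_
    intro t _
    simp [AffineMap.lineMap_apply, add_comm]
  have := hc1.le_slope_of_hasDerivAt (Set.mem_univ 0) (Set.mem_univ 1) one_pos (aux_line hg x y 0)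
  simp [slope_def_field] at this
  linarith

theorem aux_descent {f : E → ℝ} {f' : E → E} (hg : ∀ x, HasGradientAt f (f' x) x) {L : ℝ}
    (hs : ∀ x y, ‖f' x - f' y‖ ≤ L * ‖x - y‖) (x y : E) :
    f y ≤ f x + ⟪f' x, y - x⟫ + L / 2 * ‖y - x‖ ^ 2 := by
  have hd : ∀ t : ℝ, HasDerivAt (fun t : ℝ => f (x + t • (y - x)) - t * ⟪f' x, y - x⟫
      - L / 2 * ‖y - x‖ ^ 2 * t ^ 2)
      (⟪f' (x + t • (y - x)), y - x⟫ - ⟪f' x, y - x⟫ - L * ‖y - x‖ ^ 2 * t) t := by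
    intro t
    have h := ((aux_line hg x y t).sub ((hasDerivAt_id t).mul_const ⟪f' x, y - x⟫)).sub
      ((hasDerivAt_pow 2 t).const_mul (L / 2 * ‖y - x‖ ^ 2))
    have e : (⟪f' (x + t • (y - x)), y - x⟫ - ⟪f' x, y - x⟫ - L * ‖y - x‖ ^ 2 * t)
        = ⟪f' (x + t • (y - x)), y - x⟫ - 1 * ⟪f' x, y - x⟫
          - L / 2 * ‖y - x‖ ^ 2 * ((2 : ℕ) * t ^ (2 - 1)) := by
      norm_num; ring
    rw [e]
    exact h
  have ha := antitoneOn_of_deriv_nonpos (convex_Icc (0:ℝ) 1)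
    (fun t _ => (hd t).continuousAt.continuousWithinAt)
    (fun t _ => (hd t).differentiableAt.differentiableWithinAt)
    (by
      intro t ht
      rw [interior_Icc] at ht
      rw [(hd t).deriv, ← inner_sub_left]
      have h1 := real_inner_le_norm (f' (x + t • (y - x)) - f' x) (y - x)
      have h2 := hs (x + t • (y - x)) x
      rw [add_sub_cancel_left, norm_smul, Real.norm_of_nonneg ht.1.le] at h2
      have := mul_le_mul_of_nonneg_right h2 (norm_nonneg (y - x))
      nlinarith)
  have := ha (by simp : (0:ℝ) ∈ Set.Icc (0:ℝ) 1) (by simp : (1:ℝ) ∈ Set.Icc (0:ℝ) 1) zero_le_one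
  simp at this
  linarith

theorem aux_coco {f : E → ℝ} {f' : E → E} (hg : ∀ x, HasGradientAt f (f' x) x)
    (hc : ConvexOn ℝ Set.univ f) {L : ℝ} (hL : 0 < L)
    (hs : ∀ x y, ‖f' x - f' y‖ ≤ L * ‖x - y‖) (x y : E) :
    ‖f' x - f' y‖ ^ 2 ≤ 2 * L * (f x - f y - ⟪f' y, x - y⟫) := by
  set g := f' x - f' y with hgdef
  have h1 := aux_descent hg hs x (x - L⁻¹ • g)
  have h2 := aux_convex hg hc y (x - L⁻¹ • g)
  have e1 : x - L⁻¹ • g - x = - (L⁻¹ • g) := by abel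
  have e2 : x - L⁻¹ • g - y = (x - y) - L⁻¹ • g := by abel
  rw [e1, norm_neg, norm_smul, inner_neg_right, inner_smul_right, mul_pow,
    Real.norm_of_nonneg (inv_pos.2 hL).le] at h1
  rw [e2, inner_sub_right, inner_smul_right] at h2
  have e3 : ⟪f' x, g⟫ - ⟪f' y, g⟫ = ‖g‖ ^ 2 := by
    rw [← inner_sub_left, ← hgdef, real_inner_self_eq_norm_sq]
  have e4 : L⁻¹ * ⟪f' x, g⟫ = L⁻¹ * ⟪f' y, g⟫ + L⁻¹ * ‖g‖ ^ 2 := by rw [← e3]; ring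
  have e5 : L / 2 * (L⁻¹ ^ 2 * ‖g‖ ^ 2) = L⁻¹ * ‖g‖ ^ 2 / 2 := by field_simp
  have h3 : L⁻¹ * ‖g‖ ^ 2 / 2 ≤ f x - f y - ⟪f' y, x - y⟫ := by linarith
  have h4 := mul_le_mul_of_nonneg_left h3 (by positivity : 0 ≤ 2 * L)
  have e6 : 2 * L * (L⁻¹ * ‖g‖ ^ 2 / 2) = ‖g‖ ^ 2 := by field_simp
  linarith
end

theorem aux_c1 (n b : ℕ) (hb : 1 ≤ b) (hbn : b ≤ n) (i : Fin n) :
    ((((Finset.powersetCard b (Finset.univ : Finset (Fin n))).filter (fun S => i ∈ S)).card : ℝ)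
      * n = (n.choose b : ℝ) * b) := by
  have h := Finset.card_filter_powersetCard_subset {i} (Finset.univ : Finset (Fin n)) b (by simp)
    (by simpa using hb)
  simp only [Finset.singleton_subset_iff, Finset.card_univ, Fintype.card_fin,
    Finset.card_singleton] at h
  rw [h]
  obtain ⟨b, rfl⟩ : ∃ c, b = c + 1 := ⟨b - 1, by omega⟩
  obtain ⟨n, rfl⟩ : ∃ c, n = c + 1 := ⟨n - 1, by omega⟩
  have := Nat.add_one_mul_choose_eq n b
  simp only [Nat.add_sub_cancel]
  have h2 : ((n + 1 : ℕ) : ℝ) * (n.choose b : ℝ) = ((n+1).choose (b+1) : ℝ) * ((b + 1 : ℕ) : ℝ) := by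
    exact_mod_cast this
  linarith

theorem aux_c2 (n b : ℕ) (hb : 1 ≤ b) (hbn : b ≤ n) (i j : Fin n) (hij : i ≠ j) :
    ((((Finset.powersetCard b (Finset.univ : Finset (Fin n))).filter
      (fun S => i ∈ S ∧ j ∈ S)).card : ℝ)
      * (n * (n - 1)) = (n.choose b : ℝ) * (b * (b - 1))) := by
  rcases Nat.lt_or_ge b 2 with h2 | h2
  · obtain rfl : b = 1 := by omega
    rw [Finset.filter_false_of_mem]
    · simp
    · intro S hS ⟨hi, hj⟩
      rw [Finset.mem_powersetCard_univ] at hS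
      exact hij (Finset.card_le_one.1 hS.le _ hi _ hj)
  · have h := Finset.card_filter_powersetCard_subset {i, j} (Finset.univ : Finset (Fin n)) b
      (by simp) (by rw [Finset.card_pair hij]; exact h2)
    simp only [Finset.insert_subset_iff, Finset.singleton_subset_iff, Finset.card_univ,
      Fintype.card_fin, Finset.card_pair hij] at h
    rw [h]
    obtain ⟨b, rfl⟩ : ∃ c, b = c + 2 := ⟨b - 2, by omega⟩
    obtain ⟨n, rfl⟩ : ∃ c, n = c + 2 := ⟨n - 2, by omega⟩
    have t1 := Nat.add_one_mul_choose_eq n b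
    have t2 := Nat.add_one_mul_choose_eq (n + 1) (b + 1)
    simp only [Nat.add_sub_cancel]
    have h1 : ((n : ℝ) + 1) * (n.choose b : ℝ) = ((n+1).choose (b+1) : ℝ) * ((b : ℝ) + 1) := by
      exact_mod_cast t1
    have h2 : ((n : ℝ) + 1 + 1) * ((n + 1).choose (b + 1) : ℝ)
        = ((n+2).choose (b+2) : ℝ) * ((b : ℝ) + 1 + 1) := by
      exact_mod_cast t2
    push_cast
    linear_combination ((n : ℝ) + 2) * h1 + ((b : ℝ) + 1) * h2

section
variable {E : Type*} [NormedAddCommGroup E] [InnerProductSpace ℝ E]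

theorem aux_sum1 {M : Type*} [AddCommGroup M] [Module ℝ M]
    (n b : ℕ) (hb : 1 ≤ b) (hbn : b ≤ n) (w : Fin n → M) (hw : ∑ i, w i = 0) :
    ∑ S ∈ Finset.powersetCard b (Finset.univ : Finset (Fin n)), ∑ i ∈ S, w i = 0 := by
  have hn : (n : ℝ) ≠ 0 := by have : n ≠ 0 := by omega
                              exact_mod_cast this
  have e : ∀ S : Finset (Fin n), ∑ i ∈ S, w i = ∑ i, (if i ∈ S then (1 : ℝ) else 0) • w i := by
    intro S; simp [ite_smul]
  simp_rw [e]
  rw [Finset.sum_comm]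
  have e2 : ∀ i, ∑ S ∈ Finset.powersetCard b (Finset.univ : Finset (Fin n)),
      (if i ∈ S then (1 : ℝ) else 0) • w i = ((n.choose b : ℝ) * b / n) • w i := by
    intro i
    rw [← Finset.sum_smul, Finset.sum_boole, ← aux_c1 n b hb hbn i, mul_div_cancel_right₀ _ hn]
  simp_rw [e2]
  rw [← Finset.smul_sum, hw, smul_zero]

theorem aux_sum2 (n b : ℕ) (hn2 : 2 ≤ n) (hb : 1 ≤ b) (hbn : b ≤ n) (w : Fin n → E)
    (hw : ∑ i, w i = 0) :
    ∑ S ∈ Finset.powersetCard b (Finset.univ : Finset (Fin n)), ‖∑ i ∈ S, w i‖ ^ 2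
      = (n.choose b : ℝ) * (b * (n - b) / (n * (n - 1))) * ∑ i, ‖w i‖ ^ 2 := by
  have hn : (n : ℝ) ≠ 0 := by have : n ≠ 0 := by omega
                              exact_mod_cast this
  have hn1 : (n : ℝ) - 1 ≠ 0 := by
    have : (2 : ℝ) ≤ n := by exact_mod_cast hn2
    linarith
  have e : ∀ S : Finset (Fin n), ‖∑ i ∈ S, w i‖ ^ 2
      = ∑ i, ∑ j, (if i ∈ S ∧ j ∈ S then (1 : ℝ) else 0) * ⟪w i, w j⟫ := by
    intro S
    rw [← real_inner_self_eq_norm_sq, sum_inner]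
    simp_rw [inner_sum]
    simp [ite_and]
  simp_rw [e]
  rw [Finset.sum_comm]
  set C : ℝ := (n.choose b : ℝ)
  have e2 : ∀ i j, ∑ S ∈ Finset.powersetCard b (Finset.univ : Finset (Fin n)),
      (if i ∈ S ∧ j ∈ S then (1 : ℝ) else 0) * ⟪w i, w j⟫
      = C * (b * (b - 1)) / (n * (n - 1)) * ⟪w i, w j⟫
        + if i = j then C * (b * (n - b) / (n * (n - 1))) * ‖w i‖ ^ 2 else 0 := by
    intro i j
    rw [← Finset.sum_mul, Finset.sum_boole]
    by_cases hij : i = j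
    · subst hij
      simp only [and_self, if_true, real_inner_self_eq_norm_sq]
      have := aux_c1 n b hb hbn i
      rw [← eq_div_iff hn] at this
      rw [this, ← add_mul]
      congr 1
      field_simp
      ring
    · have := aux_c2 n b hb hbn i j hij
      rw [← eq_div_iff (mul_ne_zero hn hn1)] at this
      rw [this]
      simp [hij, C]
  have e3 : ∀ i, ∑ S ∈ Finset.powersetCard b (Finset.univ : Finset (Fin n)),
      ∑ j, (if i ∈ S ∧ j ∈ S then (1 : ℝ) else 0) * ⟪w i, w j⟫
      = C * (b * (n - b) / (n * (n - 1))) * ‖w i‖ ^ 2 := by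
    intro i
    rw [Finset.sum_comm]
    simp_rw [e2]
    rw [Finset.sum_add_distrib, ← Finset.mul_sum, ← inner_sum, hw]
    simp
  simp_rw [e3]
  rw [← Finset.mul_sum]

end

/-- **One-step key inequality of AMSVRG.**
Each `f i : ℝ^d → ℝ` is convex and `L`-smooth, `n ≥ 2`, `f = (1/n) Σ f i` has minimizer `x*`;
`d` is differentiable and `1`-strongly convex with Bregman divergence `V`. Fix `y₀, x, z`,
`α > 0`, a batch size `1 ≤ b ≤ n`, and `δ = (n−b)/(b(n−1))`. For each size-`b` subset `S` set
`v S = (1/b) Σ_{i∈S} (∇f_i(x) − ∇f_i(y₀)) + ∇f(y₀)`, `y S = x − (1/L) v S`, and let `z S`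
satisfy `∇d(z S) = ∇d(z) − α v S`. Then, averaging over all size-`b` subsets `S`,
`α ⟪∇f(x), z − x*⟫ ≤ V z x* − E_S[V (z S) x*] + (1+4δ) L α² (f(x) − f(x*))
  − L α² E_S[f(y S) − f(x*)] + 4 L α² δ (f(y₀) − f(x*))`. -/
theorem amsvrg_one_step_key_inequality {dd : ℕ} (n : ℕ) (hn : 2 ≤ n) (L : ℝ) (hL : 0 < L)
    (f : Fin n → EuclideanSpace ℝ (Fin dd) → ℝ)
    (f' : Fin n → EuclideanSpace ℝ (Fin dd) → EuclideanSpace ℝ (Fin dd))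
    (hgrad : ∀ i x, HasGradientAt (f i) (f' i x) x)
    (hconv : ∀ i, ConvexOn ℝ Set.univ (f i))
    (hsmooth : ∀ i x y, ‖f' i x - f' i y‖ ≤ L * ‖x - y‖)
    (F : EuclideanSpace ℝ (Fin dd) → ℝ)
    (hF : F = fun x => (n : ℝ)⁻¹ * ∑ i, f i x)
    (Fg : EuclideanSpace ℝ (Fin dd) → EuclideanSpace ℝ (Fin dd))
    (hFg : Fg = fun x => (n : ℝ)⁻¹ • ∑ i, f' i x)
    (xstar : EuclideanSpace ℝ (Fin dd)) (hmin : ∀ y, F xstar ≤ F y)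
    (d : EuclideanSpace ℝ (Fin dd) → ℝ)
    (dg : EuclideanSpace ℝ (Fin dd) → EuclideanSpace ℝ (Fin dd))
    (hdgrad : ∀ x, HasGradientAt d (dg x) x)
    (hdsc : ∀ x y, d y ≥ d x + ⟪dg x, y - x⟫ + (1 / 2) * ‖y - x‖ ^ 2)
    (V : EuclideanSpace ℝ (Fin dd) → EuclideanSpace ℝ (Fin dd) → ℝ)
    (hV : ∀ x y, V x y = d y - d x - ⟪dg x, y - x⟫)
    (y0 x z : EuclideanSpace ℝ (Fin dd)) (α : ℝ) (hα : 0 < α)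
    (b : ℕ) (hb1 : 1 ≤ b) (hbn : b ≤ n)
    (δ : ℝ) (hδ : δ = ((n : ℝ) - b) / (b * ((n : ℝ) - 1)))
    (v y : Finset (Fin n) → EuclideanSpace ℝ (Fin dd))
    (hv : ∀ S, v S = (b : ℝ)⁻¹ • (∑ i ∈ S, (f' i x - f' i y0)) + Fg y0)
    (hy : ∀ S, y S = x - L⁻¹ • v S)
    (zs : Finset (Fin n) → EuclideanSpace ℝ (Fin dd))
    (hzs : ∀ S ∈ Finset.powersetCard b (Finset.univ : Finset (Fin n)),
      dg (zs S) = dg z - α • v S) :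
    α * ⟪Fg x, z - xstar⟫ ≤
      V z xstar -
        ((n.choose b : ℝ))⁻¹ *
          ∑ S ∈ Finset.powersetCard b (Finset.univ : Finset (Fin n)), V (zs S) xstar +
      (1 + 4 * δ) * L * α ^ 2 * (F x - F xstar) -
      L * α ^ 2 *
        (((n.choose b : ℝ))⁻¹ *
          ∑ S ∈ Finset.powersetCard b (Finset.univ : Finset (Fin n)), (F (y S) - F xstar)) +
      4 * L * α ^ 2 * δ * (F y0 - F xstar) := by
  have hn0 : (0 : ℝ) < n := by
    have : 0 < n := by omega
    exact_mod_cast this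
  have hnn : (n : ℝ) ≠ 0 := hn0.ne'
  have hn1 : (0 : ℝ) < (n : ℝ) - 1 := by
    have : (2 : ℝ) ≤ n := by exact_mod_cast hn
    linarith
  have hb0 : (0 : ℝ) < b := by exact_mod_cast hb1
  have hC : (0 : ℝ) < (n.choose b : ℝ) := by exact_mod_cast Nat.choose_pos hbn
  have hδ0 : 0 ≤ δ := by
    have : (b : ℝ) ≤ n := by exact_mod_cast hbn
    rw [hδ]
    exact div_nonneg (by linarith) (by positivity)
  have hFx : ∀ p, F p = (n : ℝ)⁻¹ * ∑ i, f i p := fun p => by rw [hF]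
  have hFgx : ∀ p, Fg p = (n : ℝ)⁻¹ • ∑ i, f' i p := fun p => by rw [hFg]
  -- descent for F
  have hdesc : ∀ p q, F q ≤ F p + ⟪Fg p, q - p⟫ + L / 2 * ‖q - p‖ ^ 2 := by
    intro p q
    have h := Finset.sum_le_sum (fun i (_ : i ∈ (Finset.univ : Finset (Fin n))) =>
      aux_descent (hgrad i) (hsmooth i) p q)
    rw [Finset.sum_add_distrib, Finset.sum_add_distrib, ← sum_inner, Finset.sum_const,
      Finset.card_univ, Fintype.card_fin, nsmul_eq_mul] at h
    have h2 := mul_le_mul_of_nonneg_left h (inv_pos.2 hn0).le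
    rw [hFx, hFx, hFgx, real_inner_smul_left]
    have e : (n : ℝ)⁻¹ * (n * (L / 2 * ‖q - p‖ ^ 2)) = L / 2 * ‖q - p‖ ^ 2 := by field_simp
    linarith
  have hg0 : Fg xstar = 0 := by
    have h := hdesc xstar (xstar - L⁻¹ • Fg xstar)
    have h' := hmin (xstar - L⁻¹ • Fg xstar)
    have e1 : xstar - L⁻¹ • Fg xstar - xstar = - (L⁻¹ • Fg xstar) := by abel
    rw [e1, norm_neg, norm_smul, inner_neg_right, inner_smul_right, mul_pow,
      Real.norm_of_nonneg (inv_pos.2 hL).le, real_inner_self_eq_norm_sq] at h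
    have e5 : L / 2 * (L⁻¹ ^ 2 * ‖Fg xstar‖ ^ 2) = L⁻¹ * ‖Fg xstar‖ ^ 2 / 2 := by field_simp
    have h3 : L⁻¹ * ‖Fg xstar‖ ^ 2 ≤ 0 := by linarith
    have h4 : ‖Fg xstar‖ ^ 2 ≤ 0 := by
      by_contra hcon
      push Not at hcon
      have := mul_pos (inv_pos.2 hL) hcon
      linarith
    have h5 : ‖Fg xstar‖ = 0 := by
      have := sq_nonneg ‖Fg xstar‖
      exact pow_eq_zero_iff (two_ne_zero) |>.1 (le_antisymm h4 this)
    exact norm_eq_zero.1 h5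
  have hcoco : ∀ p, ∑ i, ‖f' i p - f' i xstar‖ ^ 2 ≤ n * (2 * L * (F p - F xstar)) := by
    intro p
    have h := Finset.sum_le_sum (fun i (_ : i ∈ (Finset.univ : Finset (Fin n))) =>
      aux_coco (hgrad i) (hconv i) hL (hsmooth i) p xstar)
    rw [← Finset.mul_sum, Finset.sum_sub_distrib, Finset.sum_sub_distrib, ← sum_inner] at h
    have e : ∑ i, f' i xstar = 0 := by
      have := hFgx xstar
      rw [hg0] at this
      exact (smul_eq_zero.1 this.symm).resolve_left (inv_ne_zero hnn)
    rw [e, inner_zero_left] at h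
    rw [hFx, hFx]
    have e2 : (n : ℝ) * (2 * L * ((n : ℝ)⁻¹ * ∑ i, f i p - (n : ℝ)⁻¹ * ∑ i, f i xstar))
      = 2 * L * (∑ i, f i p - ∑ i, f i xstar - 0) := by
      field_simp
      ring
    rw [e2]
    exact h
  set u : Fin n → EuclideanSpace ℝ (Fin dd) := fun i => f' i x - f' i y0 with hu
  set ub := Fg x - Fg y0 with hub
  set w : Fin n → EuclideanSpace ℝ (Fin dd) := fun i => u i - ub with hwdef
  have hsu : ∑ i, u i = (n : ℝ) • ub := by
    rw [hub, hFgx, hFgx, ← smul_sub, smul_smul, mul_inv_cancel₀ hnn, one_smul, hu,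
      Finset.sum_sub_distrib]
  have hw0 : ∑ i, w i = 0 := by
    rw [hwdef, Finset.sum_sub_distrib, hsu, Finset.sum_const, Finset.card_univ, Fintype.card_fin,
      Nat.cast_smul_eq_nsmul, sub_self]
  have hwu : ∑ i, ‖w i‖ ^ 2 ≤ ∑ i, ‖u i‖ ^ 2 := by
    have e : ∀ i, ‖w i‖ ^ 2 = ‖u i‖ ^ 2 - 2 * ⟪u i, ub⟫ + ‖ub‖ ^ 2 := fun i =>
      norm_sub_sq_real _ _
    simp_rw [e]
    rw [Finset.sum_add_distrib, Finset.sum_sub_distrib, ← Finset.mul_sum, ← sum_inner, hsu,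
      real_inner_smul_left, real_inner_self_eq_norm_sq, Finset.sum_const, Finset.card_univ,
      Fintype.card_fin, nsmul_eq_mul]
    nlinarith [mul_nonneg hn0.le (sq_nonneg ‖ub‖)]
  have huu : ∑ i, ‖u i‖ ^ 2 ≤ n * (4 * L * ((F x - F xstar) + (F y0 - F xstar))) := by
    have h : ∀ i, ‖u i‖ ^ 2 ≤ 2 * ‖f' i x - f' i xstar‖ ^ 2 + 2 * ‖f' i y0 - f' i xstar‖ ^ 2 := by
      intro i
      have e : u i = (f' i x - f' i xstar) - (f' i y0 - f' i xstar) := by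
        rw [hu]; simp
      have := parallelogram_law_with_norm ℝ (f' i x - f' i xstar) (f' i y0 - f' i xstar)
      rw [e]
      nlinarith [mul_self_nonneg ‖(f' i x - f' i xstar) + (f' i y0 - f' i xstar)‖]
    have h2 := Finset.sum_le_sum (fun i (_ : i ∈ (Finset.univ : Finset (Fin n))) => h i)
    rw [Finset.sum_add_distrib, ← Finset.mul_sum, ← Finset.mul_sum] at h2
    have := hcoco x
    have := hcoco y0
    linarith
  set P := Finset.powersetCard b (Finset.univ : Finset (Fin n)) with hP
  have hcard : (P.card : ℝ) = (n.choose b : ℝ) := by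
    rw [hP, Finset.card_powersetCard, Finset.card_univ, Fintype.card_fin]
  set e : Finset (Fin n) → EuclideanSpace ℝ (Fin dd) := fun S => (b : ℝ)⁻¹ • ∑ i ∈ S, w i with he
  have hve : ∀ S ∈ P, v S = Fg x + e S := by
    intro S hS
    have hSc : S.card = b := Finset.mem_powersetCard_univ.1 hS
    have e1 : e S = (b : ℝ)⁻¹ • (∑ i ∈ S, u i) - ub := by
      simp only [he, hwdef]
      rw [Finset.sum_sub_distrib, Finset.sum_const, hSc, smul_sub,
        ← Nat.cast_smul_eq_nsmul ℝ, smul_smul, inv_mul_cancel₀ hb0.ne', one_smul]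
    rw [hv, e1, hub]
    abel
  have hes : ∑ S ∈ P, e S = 0 := by
    simp only [he]
    rw [← Finset.smul_sum, hP, aux_sum1 n b hb1 hbn w hw0, smul_zero]
  have hes2 : ∑ S ∈ P, ‖e S‖ ^ 2
      ≤ (n.choose b : ℝ) * (δ * (4 * L * ((F x - F xstar) + (F y0 - F xstar)))) := by
    have e1 : ∑ S ∈ P, ‖e S‖ ^ 2 = (n.choose b : ℝ) * δ * (n : ℝ)⁻¹ * ∑ i, ‖w i‖ ^ 2 := by
      simp only [he, norm_smul, mul_pow]
      rw [← Finset.mul_sum, hP, aux_sum2 n b hn hb1 hbn w hw0, hδ, Real.norm_of_nonneg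
        (inv_pos.2 hb0).le]
      have := hn1.ne'
      have := hb0.ne'
      field_simp
    rw [e1]
    have h1 := mul_le_mul_of_nonneg_left (hwu.trans huu)
      (by positivity : 0 ≤ (n.choose b : ℝ) * δ * (n : ℝ)⁻¹)
    refine h1.trans (le_of_eq ?_)
    field_simp
  have key : ∀ S ∈ P, α * ⟪Fg x, z - xstar⟫ + ⟪e S, α • (z - xstar) - α ^ 2 • Fg x⟫
      + V (zs S) xstar + L * α ^ 2 * (F (y S) - F xstar)
      ≤ V z xstar + L * α ^ 2 * (F x - F xstar) + α ^ 2 * ‖e S‖ ^ 2 := by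
    intro S hS
    -- mirror step
    have m1 : α * ⟪v S, z - xstar⟫ ≤ V z xstar - V (zs S) xstar + α ^ 2 / 2 * ‖v S‖ ^ 2 := by
      have h1 := hdsc z (zs S)
      have h2 : ⟪dg (zs S), xstar - zs S⟫
          = ⟪dg z, xstar - zs S⟫ - α * ⟪v S, xstar - zs S⟫ := by
        rw [hzs S hS, inner_sub_left, real_inner_smul_left]
      have h3 := sq_nonneg ‖α • v S + (zs S - z)‖
      have h3' := norm_add_sq_real (α • v S) (zs S - z)
      rw [h3', norm_smul, mul_pow, Real.norm_of_nonneg hα.le, real_inner_smul_left] at h3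
      rw [hV, hV, h2]
      simp only [inner_sub_right] at *
      nlinarith
    have m2 := hdesc x (y S)
    have ey : y S - x = - (L⁻¹ • v S) := by rw [hy]; abel
    rw [ey, norm_neg, norm_smul, inner_neg_right, inner_smul_right, mul_pow,
      Real.norm_of_nonneg (inv_pos.2 hL).le] at m2
    have m3 := mul_le_mul_of_nonneg_left m2 (by positivity : 0 ≤ L * α ^ 2)
    have e3 : L * α ^ 2 * (F x + -(L⁻¹ * ⟪Fg x, v S⟫) + L / 2 * (L⁻¹ ^ 2 * ‖v S‖ ^ 2))
        = L * α ^ 2 * F x - α ^ 2 * ⟪Fg x, v S⟫ + α ^ 2 / 2 * ‖v S‖ ^ 2 := by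
      field_simp
      ring
    rw [e3] at m3
    have e4 : ‖v S‖ ^ 2 = ‖Fg x‖ ^ 2 + 2 * ⟪Fg x, e S⟫ + ‖e S‖ ^ 2 := by
      rw [hve S hS]; exact norm_add_sq_real _ _
    have e5 : ⟪Fg x, v S⟫ = ‖Fg x‖ ^ 2 + ⟪Fg x, e S⟫ := by
      rw [hve S hS, inner_add_right, real_inner_self_eq_norm_sq]
    have e6 : ⟪v S, z - xstar⟫ = ⟪Fg x, z - xstar⟫ + ⟪e S, z - xstar⟫ := by
      rw [hve S hS, inner_add_left]
    rw [e4, e6] at m1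
    rw [e4, e5] at m3
    have e7 : ⟪e S, α • (z - xstar) - α ^ 2 • Fg x⟫
        = α * ⟪e S, z - xstar⟫ - α ^ 2 * ⟪Fg x, e S⟫ := by
      rw [inner_sub_right, inner_smul_right, inner_smul_right, real_inner_comm (Fg x)]
    rw [e7]
    linarith
  have hsum := Finset.sum_le_sum key
  simp only [Finset.sum_add_distrib, ← Finset.mul_sum, ← sum_inner, hes, inner_zero_left,
    Finset.sum_const, nsmul_eq_mul, hcard] at hsum
  have hfin := mul_le_mul_of_nonneg_left (hsum.trans (add_le_add_right
    (mul_le_mul_of_nonneg_left hes2 (sq_nonneg α)) _)) (inv_pos.2 hC).le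
  have c1 : ∀ r : ℝ, (n.choose b : ℝ)⁻¹ * ((n.choose b : ℝ) * r) = r := fun r =>
    inv_mul_cancel_left₀ hC.ne' r
  have r1 := c1 (α * ⟪Fg x, z - xstar⟫)
  have r2 := c1 (V z xstar)
  have r3 := c1 (L * α ^ 2 * (F x - F xstar))
  have r5 : (n.choose b : ℝ)⁻¹ * (α ^ 2 * ((n.choose b : ℝ)
    * (δ * (4 * L * ((F x - F xstar) + (F y0 - F xstar))))))
    = α ^ 2 * (δ * (4 * L * ((F x - F xstar) + (F y0 - F xstar)))) := by
    field_simp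
  simp only [mul_add ((n.choose b : ℝ)⁻¹)] at hfin
  rw [r5] at hfin
  have r6 : ⟪P.card • Fg x, z - xstar⟫ = (n.choose b : ℝ) * ⟪Fg x, z - xstar⟫ := by
    rw [← Nat.cast_smul_eq_nsmul ℝ, hcard, real_inner_smul_left]
  rw [r6] at hfin
  linarith
end

section
/- (Lemma 2, key lemma for Algorithm 1.) Suppose each f_i is convex and L-smooth, n ≥ 2, and x* is a minimizer of f. Let d : ℝ^d → ℝ be differentiable and 1-strongly convex with Bregman divergence V. Fix m ∈ ℕ, step sizes α_1, …, α_{m+1} > 0, convex-combination weights τ_0, …, τ_m ∈ (0, 1], batch sizes b_1, …, b_{m+1} ∈ {1,…,n}, and set δ_k = (n−b_k)/(b_k(n−1)). Let Ω be the finite product, over k = 1,…,m+1, of the sets of size-b_k subsets of {1,…,n}, equipped with the uniform probability measure, and for ω = (S_1,…,S_{m+1}) ∈ Ω define recursively, starting from y_0, z_0 ∈ ℝ^d: x_{k+1} = (1−τ_k)·y_k + τ_k·z_k; v_{k+1} = (1/b_{k+1})·Σ_{i∈S_{k+1}}(∇f_i(x_{k+1}) − ∇f_i(y_0)) + ∇f(y_0);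 y_{k+1} = x_{k+1} − (1/L)·v_{k+1}; and z_{k+1} satisfying ∇d(z_{k+1}) = ∇d(z_k) − α_{k+1}·v_{k+1}. Then, with E denoting expectation (average) over Ω: Σ_{k=0}^{m} α_{k+1}·( 1/τ_k − (1+4δ_{k+1})·L·α_{k+1} )·E[f(x_{k+1}) − f(x*)] + L·α_{m+1}²·E[f(y_{m+1}) − f(x*)] ≤ V_{z_0}(x*) + Σ_{k=1}^{m} ( α_{k+1}·(1−τ_k)/τ_k − L·α_k² )·E[f(y_k) − f(x*)] + ( α_1·(1−τ_0)/τ_0 + 4L·Σ_{k=0}^{m} α_{k+1}²·δ_{k+1} )·( f(y_0) − f(x*) ). -/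
open RealInnerProductSpace


namespace AMSVRG

section Analysis
set_option linter.unusedSectionVars false
variable {H : Type*} [NormedAddCommGroup H] [InnerProductSpace ℝ H] [CompleteSpace H]

lemma line_deriv {f : H → ℝ} {f' : H → H} (hg : ∀ x, HasGradientAt f (f' x) x) (x u : H) (t : ℝ) :
    HasDerivAt (fun t : ℝ => f (x + t • u)) ⟪f' (x + t • u), u⟫ t := by
  have h1 : HasDerivAt (fun t : ℝ => x + t • u) u t := by
    simpa using ((hasDerivAt_id t).smul_const u).const_add x
  have h2 := (hg (x + t • u)).hasFDerivAt
  have h3 := h2.comp_hasDerivAt t h1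
  simpa [Function.comp_def] using h3

lemma convex_lower {f : H → ℝ} {f' : H → H} (hg : ∀ x, HasGradientAt f (f' x) x)
    (hc : ConvexOn ℝ Set.univ f) (x y : H) : f x + ⟪f' x, y - x⟫ ≤ f y := by
  have hd := line_deriv hg x (y - x) 0
  have hc2 : ConvexOn ℝ Set.univ (fun t : ℝ => f (x + t • (y - x))) := by
    have := hc.comp_affineMap (AffineMap.lineMap x y : ℝ →ᵃ[ℝ] H)
    simpa [Function.comp_def, AffineMap.lineMap_apply, add_comm] using this
  have := hc2.le_slope_of_hasDerivAt (Set.mem_univ _) (Set.mem_univ _) zero_lt_one hd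
  simp [slope_def_field] at this
  linarith

lemma descent {f : H → ℝ} {f' : H → H} {L : ℝ} (hg : ∀ x, HasGradientAt f (f' x) x)
    (hs : ∀ x y, ‖f' x - f' y‖ ≤ L * ‖x - y‖) (x y : H) :
    f y ≤ f x + ⟪f' x, y - x⟫ + L / 2 * ‖y - x‖ ^ 2 := by
  set u := y - x with hu
  have hB : ∀ t : ℝ, HasDerivAt (fun t : ℝ => f x + t * ⟪f' x, u⟫ + L / 2 * ‖u‖ ^ 2 * t ^ 2)
      (⟪f' x, u⟫ + L * ‖u‖ ^ 2 * t) t := by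
    intro t
    have h1 := ((hasDerivAt_id t).mul_const ⟪f' x, u⟫).const_add (f x)
    have h2 := ((hasDerivAt_pow 2 t).const_mul (L / 2 * ‖u‖ ^ 2))
    refine HasDerivAt.congr_deriv (h1.add h2) ?_
    norm_num; ring
  have key := image_le_of_deriv_right_le_deriv_boundary (a := 0) (b := 1)
    (f := fun t : ℝ => f (x + t • u)) (f' := fun t => ⟪f' (x + t • u), u⟫)
    (B := fun t : ℝ => f x + t * ⟪f' x, u⟫ + L / 2 * ‖u‖ ^ 2 * t ^ 2)
    (B' := fun t => ⟪f' x, u⟫ + L * ‖u‖ ^ 2 * t)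
    (fun t _ => (line_deriv hg x u t).continuousAt.continuousWithinAt)
    (fun t _ => (line_deriv hg x u t).hasDerivWithinAt)
    (by simp) (fun t _ => (hB t).continuousAt.continuousWithinAt)
    (fun t _ => (hB t).hasDerivWithinAt)
    (by
      intro t ht
      have h1 : ⟪f' (x + t • u) - f' x, u⟫ ≤ ‖f' (x + t • u) - f' x‖ * ‖u‖ :=
        real_inner_le_norm _ _
      have h2 := hs (x + t • u) x
      rw [add_sub_cancel_left, norm_smul, Real.norm_of_nonneg ht.1] at h2
      have h3 := mul_le_mul_of_nonneg_right h2 (norm_nonneg u)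
      rw [inner_sub_left] at h1
      nlinarith)
  have := key (Set.right_mem_Icc.2 zero_le_one)
  simp [hu] at this
  rw [← hu] at this
  linarith

lemma cocoercive {f : H → ℝ} {f' : H → H} {L : ℝ} (hL : 0 < L)
    (hg : ∀ x, HasGradientAt f (f' x) x) (hc : ConvexOn ℝ Set.univ f)
    (hs : ∀ x y, ‖f' x - f' y‖ ≤ L * ‖x - y‖) (x w : H) :
    ‖f' x - f' w‖ ^ 2 ≤ 2 * L * (f x - f w - ⟪f' w, x - w⟫) := by
  set g := f' x - f' w with hgdef
  have h1 := convex_lower hg hc w (x - L⁻¹ • g)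
  have h2 := descent hg hs x (x - L⁻¹ • g)
  have e1 : x - L⁻¹ • g - w = (x - w) - L⁻¹ • g := by abel
  have e2 : x - L⁻¹ • g - x = - (L⁻¹ • g) := by abel
  rw [e1, inner_sub_right, inner_smul_right] at h1
  rw [e2, inner_neg_right, inner_smul_right, norm_neg, norm_smul, mul_pow, Real.norm_eq_abs,
    sq_abs] at h2
  have h3 : ⟪f' x, g⟫ - ⟪f' w, g⟫ = ‖g‖ ^ 2 := by
    rw [← inner_sub_left, ← hgdef, real_inner_self_eq_norm_sq]
  have h4 : L⁻¹ * ⟪f' x, g⟫ = L⁻¹ * ⟪f' w, g⟫ + L⁻¹ * ‖g‖ ^ 2 := by rw [← h3]; ring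
  have h5 : L / 2 * (L⁻¹ ^ 2 * ‖g‖ ^ 2) = L⁻¹ * ‖g‖ ^ 2 / 2 := by field_simp
  have h6 : L⁻¹ * ‖g‖ ^ 2 / 2 ≤ f x - f w - ⟪f' w, x - w⟫ := by linarith
  have h7 := mul_le_mul_of_nonneg_left h6 (by positivity : 0 ≤ 2 * L)
  have h8 : 2 * L * (L⁻¹ * ‖g‖ ^ 2 / 2) = ‖g‖ ^ 2 := by field_simp
  linarith

lemma mirror_step {d : H → ℝ} {dg : H → H}
    (hdsc : ∀ x y, d y ≥ d x + ⟪dg x, y - x⟫ + (1 / 2) * ‖y - x‖ ^ 2)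
    {V : H → H → ℝ} (hV : ∀ x y, V x y = d y - d x - ⟪dg x, y - x⟫)
    (z zp v u : H) (a : ℝ) (hz : dg zp = dg z - a • v) :
    a * ⟪v, z - u⟫ ≤ a ^ 2 / 2 * ‖v‖ ^ 2 + V z u - V zp u := by
  have h1 := hdsc z zp
  rw [hV, hV, hz, inner_sub_left, inner_smul_left]
  simp only [conj_trivial]
  have e1 : ⟪dg z, u - zp⟫ = ⟪dg z, u - z⟫ - ⟪dg z, zp - z⟫ := by
    rw [← inner_sub_right]; congr 1; abel
  have e2 : ⟪v, u - zp⟫ = - ⟪v, z - u⟫ - ⟪v, zp - z⟫ := by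
    rw [← inner_neg_right, ← inner_sub_right]; congr 1; abel
  have h3 : 0 ≤ ‖a • v + (zp - z)‖ ^ 2 := by positivity
  rw [norm_add_sq_real, inner_smul_left, norm_smul, mul_pow, Real.norm_eq_abs, sq_abs] at h3
  simp only [conj_trivial] at h3
  rw [e1, e2]
  nlinarith

lemma dg_inj {d : H → ℝ} {dg : H → H}
    (hdsc : ∀ x y, d y ≥ d x + ⟪dg x, y - x⟫ + (1 / 2) * ‖y - x‖ ^ 2)
    {p q : H} (h : dg p = dg q) : p = q := by
  have h1 := hdsc p q
  have h2 := hdsc q p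
  rw [h] at h1
  have e : ⟪dg q, p - q⟫ = - ⟪dg q, q - p⟫ := by
    rw [← inner_neg_right]; congr 1; abel
  rw [e, norm_sub_rev p q] at h2
  have : ‖q - p‖ ^ 2 ≤ 0 := by linarith
  have h0 : ‖q - p‖ = 0 := by nlinarith [norm_nonneg (q - p)]
  exact (sub_eq_zero.1 (norm_eq_zero.1 h0)).symm

end Analysis

section Sampling
variable {H : Type*} [NormedAddCommGroup H] [InnerProductSpace ℝ H]

lemma count_one {n b : ℕ} (hb : 1 ≤ b) (i : Fin n) :
    (n : ℝ) * ∑ S ∈ Finset.powersetCard b (Finset.univ : Finset (Fin n)),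
      (if i ∈ S then (1 : ℝ) else 0) = b * (n.choose b : ℝ) := by
  rw [Finset.sum_boole]
  have h := Finset.card_filter_powersetCard_subset {i} (Finset.univ : Finset (Fin n)) b
    (by simp) (by simpa)
  simp only [Finset.singleton_subset_iff, Finset.card_univ, Fintype.card_fin,
    Finset.card_singleton] at h
  rw [h]
  obtain ⟨n, rfl⟩ : ∃ k, n = k + 1 := ⟨n - 1, by have := i.pos; omega⟩
  obtain ⟨b, rfl⟩ : ∃ k, b = k + 1 := ⟨b - 1, by omega⟩
  have := Nat.add_one_mul_choose_eq n b
  rw [Nat.add_sub_cancel, Nat.add_sub_cancel, mul_comm ((b + 1 : ℕ) : ℝ)]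
  exact_mod_cast this

lemma count_two {n b : ℕ} (hb : 1 ≤ b) (i j : Fin n) (hij : i ≠ j) :
    (n : ℝ) * ((n : ℝ) - 1) * ∑ S ∈ Finset.powersetCard b (Finset.univ : Finset (Fin n)),
      (if i ∈ S ∧ j ∈ S then (1 : ℝ) else 0) = b * ((b : ℝ) - 1) * (n.choose b : ℝ) := by
  rw [Finset.sum_boole]
  have hn : 2 ≤ n := by
    have := i.2; have := j.2
    by_contra hh
    exact hij (Fin.ext (by omega))
  obtain ⟨n, rfl⟩ : ∃ k, n = k + 2 := ⟨n - 2, by omega⟩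
  rcases Nat.lt_or_ge b 2 with hb2 | hb2
  · obtain rfl : b = 1 := by omega
    rw [Finset.filter_false_of_mem]
    · simp
    · rintro S hS ⟨h1, h2⟩
      rw [Finset.mem_powersetCard_univ] at hS
      obtain ⟨a, rfl⟩ := Finset.card_eq_one.1 hS
      simp at h1 h2
      exact hij (h1.trans h2.symm)
  have h := Finset.card_filter_powersetCard_subset {i, j} (Finset.univ : Finset (Fin (n + 2))) b
    (by simp) (by rw [Finset.card_pair hij]; exact hb2)
  simp only [Finset.insert_subset_iff, Finset.singleton_subset_iff, Finset.card_univ,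
    Fintype.card_fin, Finset.card_pair hij] at h
  rw [h]
  obtain ⟨b, rfl⟩ : ∃ k, b = k + 2 := ⟨b - 2, by omega⟩
  have h1 := Nat.add_one_mul_choose_eq (n + 1) (b + 1)
  have h2 := Nat.add_one_mul_choose_eq n b
  rw [Nat.add_sub_cancel, Nat.add_sub_cancel]
  have h1' : ((n : ℝ) + 1 + 1) * ((n + 1).choose (b + 1) : ℝ)
      = ((n + 2).choose (b + 2) : ℝ) * ((b : ℝ) + 1 + 1) := by exact_mod_cast h1
  have h2' : ((n : ℝ) + 1) * (n.choose b : ℝ)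
      = ((n + 1).choose (b + 1) : ℝ) * ((b : ℝ) + 1) := by exact_mod_cast h2
  push_cast
  linear_combination ((n : ℝ) + 2) * h2' + ((b : ℝ) + 1) * h1'

lemma sample_mean {n b : ℕ} (hn : 2 ≤ n) (hb : 1 ≤ b) (ζ : Fin n → H) :
    ∑ S ∈ Finset.powersetCard b (Finset.univ : Finset (Fin n)), ∑ i ∈ S, ζ i
      = ((b : ℝ) * (n.choose b : ℝ) / n) • ∑ i, ζ i := by
  have hn0 : (n : ℝ) ≠ 0 := by positivity
  have h1 : ∀ S : Finset (Fin n), ∑ i ∈ S, ζ i = ∑ i, (if i ∈ S then (1 : ℝ) else 0) • ζ i := by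
    intro S; simp [ite_smul, Finset.sum_ite_mem]
  rw [Finset.sum_congr rfl fun S _ => h1 S]
  rw [Finset.sum_comm, Finset.smul_sum]
  refine Finset.sum_congr rfl fun i _ => ?_
  rw [← Finset.sum_smul]
  congr 1
  rw [eq_div_iff hn0, mul_comm, count_one hb i]

lemma sample_sq {n b : ℕ} (hn : 2 ≤ n) (hb : 1 ≤ b) (ξ : Fin n → H) (h0 : ∑ i, ξ i = 0) :
    ∑ S ∈ Finset.powersetCard b (Finset.univ : Finset (Fin n)), ‖∑ i ∈ S, ξ i‖ ^ 2
      = ((b : ℝ) * ((n : ℝ) - b) * (n.choose b : ℝ) / (n * ((n : ℝ) - 1))) * ∑ i, ‖ξ i‖ ^ 2 := by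
  have hn0 : (n : ℝ) ≠ 0 := by positivity
  have hn1 : (n : ℝ) - 1 ≠ 0 := by
    have : (2 : ℝ) ≤ n := by exact_mod_cast hn
    linarith
  have h1 : ∀ S : Finset (Fin n), ‖∑ i ∈ S, ξ i‖ ^ 2
      = ∑ i, ∑ j, (if i ∈ S ∧ j ∈ S then (1 : ℝ) else 0) * ⟪ξ i, ξ j⟫ := by
    intro S
    have e : ∑ i ∈ S, ξ i = ∑ i, (if i ∈ S then (1 : ℝ) else 0) • ξ i := by
      simp [ite_smul, Finset.sum_ite_mem]
    rw [← real_inner_self_eq_norm_sq, e, sum_inner]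
    refine Finset.sum_congr rfl fun i _ => ?_
    rw [inner_sum]
    refine Finset.sum_congr rfl fun j _ => ?_
    rw [inner_smul_left, inner_smul_right]
    by_cases hi : i ∈ S <;> by_cases hj : j ∈ S <;> simp [hi, hj]
  simp_rw [h1]
  rw [Finset.sum_comm]
  set N : ℝ := (n.choose b : ℝ)
  set c2 : ℝ := b * ((b : ℝ) - 1) * N / (n * ((n : ℝ) - 1)) with hc2
  have h2 : ∀ i j : Fin n, ∑ S ∈ Finset.powersetCard b (Finset.univ : Finset (Fin n)),
      (if i ∈ S ∧ j ∈ S then (1 : ℝ) else 0) * ⟪ξ i, ξ j⟫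
      = c2 * ⟪ξ i, ξ j⟫ + (if i = j then (b * N / n - c2) * ‖ξ i‖ ^ 2 else 0) := by
    intro i j
    rw [← Finset.sum_mul]
    by_cases hij : i = j
    · subst hij
      have := count_one hb i
      simp only [and_self, if_true]
      rw [real_inner_self_eq_norm_sq]
      rw [show ∑ S ∈ Finset.powersetCard b (Finset.univ : Finset (Fin n)),
        (if i ∈ S then (1 : ℝ) else 0) = b * N / n by rw [eq_div_iff hn0, mul_comm, this]]
      ring
    · have := count_two hb i j hij
      rw [if_neg hij, add_zero]
      congr 1
      rw [hc2, eq_div_iff (mul_ne_zero hn0 hn1), mul_comm, this]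
  have h3 : ∀ i : Fin n, ∑ S ∈ Finset.powersetCard b (Finset.univ : Finset (Fin n)), ∑ j,
      (if i ∈ S ∧ j ∈ S then (1 : ℝ) else 0) * ⟪ξ i, ξ j⟫ = (b * N / n - c2) * ‖ξ i‖ ^ 2 := by
    intro i
    rw [Finset.sum_comm]
    simp_rw [h2 i]
    rw [Finset.sum_add_distrib, ← Finset.mul_sum, ← inner_sum, h0]
    simp
  rw [Finset.sum_congr rfl fun i _ => h3 i, ← Finset.mul_sum]
  congr 1
  rw [hc2]
  field_simp
  ring

end Sampling

lemma sum_sub {n b : ℕ} {M : Type*} [AddCommMonoid M]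
    [I : Fintype {S : Finset (Fin n) // S ∈ Finset.powersetCard b Finset.univ}]
    (h : Finset (Fin n) → M) :
    ∑ S : {S : Finset (Fin n) // S ∈ Finset.powersetCard b Finset.univ}, h S.1
      = ∑ S ∈ Finset.powersetCard b Finset.univ, h S :=
  (Finset.sum_subtype _ (fun _ => Iff.rfl) h).symm

lemma card_sub {n b : ℕ}
    [I : Fintype {S : Finset (Fin n) // S ∈ Finset.powersetCard b Finset.univ}] :
    Fintype.card {S : Finset (Fin n) // S ∈ Finset.powersetCard b Finset.univ} = n.choose b := by
  have := sum_sub (b := b) (n := n) (fun _ => (1 : ℕ))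
  simpa using this

section Step
variable {H : Type*} [NormedAddCommGroup H] [InnerProductSpace ℝ H] [CompleteSpace H]

lemma F_lower {n : ℕ} (hn : 2 ≤ n) {f : Fin n → H → ℝ} {f' : Fin n → H → H}
    (hgrad : ∀ i x, HasGradientAt (f i) (f' i x) x) (hconv : ∀ i, ConvexOn ℝ Set.univ (f i))
    {F : H → ℝ} (hF : F = fun x => (n : ℝ)⁻¹ * ∑ i, f i x)
    {Fg : H → H} (hFg : Fg = fun x => (n : ℝ)⁻¹ • ∑ i, f' i x) (x y : H) :
    F x + ⟪Fg x, y - x⟫ ≤ F y := by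
  subst hF hFg
  simp only [inner_smul_left, conj_trivial, sum_inner]
  rw [← mul_add, ← Finset.sum_add_distrib]
  exact mul_le_mul_of_nonneg_left
    (Finset.sum_le_sum fun i _ => convex_lower (hgrad i) (hconv i) x y) (by positivity)

lemma F_descent {n : ℕ} (hn : 2 ≤ n) {L : ℝ} {f : Fin n → H → ℝ} {f' : Fin n → H → H}
    (hgrad : ∀ i x, HasGradientAt (f i) (f' i x) x)
    (hsmooth : ∀ i x y, ‖f' i x - f' i y‖ ≤ L * ‖x - y‖)
    {F : H → ℝ} (hF : F = fun x => (n : ℝ)⁻¹ * ∑ i, f i x)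
    {Fg : H → H} (hFg : Fg = fun x => (n : ℝ)⁻¹ • ∑ i, f' i x) (x y : H) :
    F y ≤ F x + ⟪Fg x, y - x⟫ + L / 2 * ‖y - x‖ ^ 2 := by
  subst hF hFg
  have hn0 : (n : ℝ) ≠ 0 := by positivity
  simp only [inner_smul_left, conj_trivial, sum_inner]
  have h := mul_le_mul_of_nonneg_left
    (Finset.sum_le_sum fun i (_ : i ∈ Finset.univ) => descent (hgrad i) (hsmooth i) x y)
    (by positivity : 0 ≤ (n : ℝ)⁻¹)
  refine h.trans (le_of_eq ?_)
  rw [Finset.sum_add_distrib, Finset.sum_add_distrib]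
  simp only [Finset.sum_const, Finset.card_univ, Fintype.card_fin, nsmul_eq_mul]
  field_simp

lemma Fg_star {n : ℕ} (hn : 2 ≤ n) {L : ℝ} (hL : 0 < L) {f : Fin n → H → ℝ} {f' : Fin n → H → H}
    (hgrad : ∀ i x, HasGradientAt (f i) (f' i x) x)
    (hsmooth : ∀ i x y, ‖f' i x - f' i y‖ ≤ L * ‖x - y‖)
    {F : H → ℝ} (hF : F = fun x => (n : ℝ)⁻¹ * ∑ i, f i x)
    {Fg : H → H} (hFg : Fg = fun x => (n : ℝ)⁻¹ • ∑ i, f' i x)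
    {xstar : H} (hmin : ∀ y, F xstar ≤ F y) : Fg xstar = 0 := by
  have h1 := F_descent hn hgrad hsmooth hF hFg xstar (xstar - L⁻¹ • Fg xstar)
  have h2 := hmin (xstar - L⁻¹ • Fg xstar)
  rw [sub_sub_cancel_left, inner_neg_right, inner_smul_right, norm_neg, norm_smul, mul_pow,
    Real.norm_eq_abs, sq_abs, real_inner_self_eq_norm_sq] at h1
  have h5 : L / 2 * (L⁻¹ ^ 2 * ‖Fg xstar‖ ^ 2) = L⁻¹ * ‖Fg xstar‖ ^ 2 / 2 := by field_simp
  have h6 : L⁻¹ * ‖Fg xstar‖ ^ 2 ≤ 0 := by linarith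
  have hLi : 0 < L⁻¹ := by positivity
  have h7 : ‖Fg xstar‖ ^ 2 ≤ 0 := by
    by_contra hh
    push Not at hh
    have := mul_pos hLi hh
    linarith
  exact norm_eq_zero.1 (by nlinarith [norm_nonneg (Fg xstar)])

lemma grad_diff_bound {n : ℕ} (hn : 2 ≤ n) {L : ℝ} (hL : 0 < L)
    {f : Fin n → H → ℝ} {f' : Fin n → H → H}
    (hgrad : ∀ i x, HasGradientAt (f i) (f' i x) x) (hconv : ∀ i, ConvexOn ℝ Set.univ (f i))
    (hsmooth : ∀ i x y, ‖f' i x - f' i y‖ ≤ L * ‖x - y‖)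
    {F : H → ℝ} (hF : F = fun x => (n : ℝ)⁻¹ * ∑ i, f i x)
    {Fg : H → H} (hFg : Fg = fun x => (n : ℝ)⁻¹ • ∑ i, f' i x)
    {xstar : H} (hmin : ∀ y, F xstar ≤ F y) (x y0 : H) :
    ∑ i, ‖f' i x - f' i y0‖ ^ 2 ≤ n * (4 * L * ((F x - F xstar) + (F y0 - F xstar))) := by
  have hn0 : (n : ℝ) ≠ 0 := by positivity
  have hs0 : ∑ i, f' i xstar = 0 := by
    have h := Fg_star hn hL hgrad hsmooth hF hFg hmin
    rw [hFg] at h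
    simpa [hn0] using h
  have hFn : ∀ w, ∑ i, f i w = n * F w := by
    intro w; rw [hF]; field_simp
  have hi : ∀ i, ‖f' i x - f' i y0‖ ^ 2 ≤ 4 * L * ((f i x - f i xstar - ⟪f' i xstar, x - xstar⟫)
      + (f i y0 - f i xstar - ⟪f' i xstar, y0 - xstar⟫)) := by
    intro i
    have h1 := cocoercive hL (hgrad i) (hconv i) (hsmooth i) x xstar
    have h2 := cocoercive hL (hgrad i) (hconv i) (hsmooth i) y0 xstar
    have h3 := parallelogram_law_with_norm ℝ (f' i x - f' i xstar) (f' i y0 - f' i xstar)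
    rw [sub_sub_sub_cancel_right] at h3
    nlinarith [mul_self_nonneg ‖f' i x - f' i xstar + (f' i y0 - f' i xstar)‖]
  refine (Finset.sum_le_sum fun i _ => hi i).trans (le_of_eq ?_)
  rw [← Finset.mul_sum]
  simp only [Finset.sum_add_distrib, Finset.sum_sub_distrib, ← sum_inner, hs0, inner_zero_left, hFn]
  ring

lemma v_mean {n b : ℕ} (hn : 2 ≤ n) (hb : 1 ≤ b) {f' : Fin n → H → H}
    {Fg : H → H} (hFg : Fg = fun x => (n : ℝ)⁻¹ • ∑ i, f' i x) (x y0 : H)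
    [I : Fintype {S : Finset (Fin n) // S ∈ Finset.powersetCard b Finset.univ}]
    (v : {S : Finset (Fin n) // S ∈ Finset.powersetCard b Finset.univ} → H)
    (hv : ∀ S, v S = (b : ℝ)⁻¹ • (∑ i ∈ S.1, (f' i x - f' i y0)) + Fg y0) :
    ∑ S, v S = (n.choose b : ℝ) • Fg x := by
  have hn0 : (n : ℝ) ≠ 0 := by positivity
  have hb0 : (b : ℝ) ≠ 0 := by positivity
  simp_rw [hv]
  rw [Finset.sum_add_distrib, ← Finset.smul_sum,
    sum_sub (fun S => ∑ i ∈ S, (f' i x - f' i y0)), sample_mean hn hb, smul_smul, hFg]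
  simp only [Finset.sum_const, Finset.card_univ, card_sub, Finset.sum_sub_distrib]
  rw [← Nat.cast_smul_eq_nsmul ℝ, smul_smul, smul_smul, smul_sub]
  have e : (b : ℝ)⁻¹ * ((b : ℝ) * (n.choose b : ℝ) / n) = (n.choose b : ℝ) * (n : ℝ)⁻¹ := by
    field_simp
  rw [e, sub_add_cancel]

lemma v_var {n b : ℕ} (hn : 2 ≤ n) (hb : 1 ≤ b) (hbn : b ≤ n) {f' : Fin n → H → H}
    {Fg : H → H} (hFg : Fg = fun x => (n : ℝ)⁻¹ • ∑ i, f' i x) (x y0 : H)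
    [I : Fintype {S : Finset (Fin n) // S ∈ Finset.powersetCard b Finset.univ}]
    (v : {S : Finset (Fin n) // S ∈ Finset.powersetCard b Finset.univ} → H)
    (hv : ∀ S, v S = (b : ℝ)⁻¹ • (∑ i ∈ S.1, (f' i x - f' i y0)) + Fg y0) {B : ℝ}
    (hB : ∑ i, ‖f' i x - f' i y0‖ ^ 2 ≤ n * B) :
    ∑ S, ‖v S - Fg x‖ ^ 2
      ≤ (n.choose b : ℝ) * (((n : ℝ) - b) / (b * ((n : ℝ) - 1)) * B) := by
  have hn0 : (n : ℝ) ≠ 0 := by positivity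
  have hb0 : (b : ℝ) ≠ 0 := by positivity
  have hn2 : (2 : ℝ) ≤ n := by exact_mod_cast hn
  have hbn' : (b : ℝ) ≤ n := by exact_mod_cast hbn
  have hn1 : (n : ℝ) - 1 ≠ 0 := by linarith
  set D : Fin n → H := fun i => f' i x - f' i y0 with hD
  set μ : H := (n : ℝ)⁻¹ • ∑ i, D i with hμ
  have hμF : μ = Fg x - Fg y0 := by
    rw [hμ, hFg, hD]; simp only [Finset.sum_sub_distrib, smul_sub]
  have hnμ : ∑ i, D i = (n : ℝ) • μ := by rw [hμ, smul_smul, mul_inv_cancel₀ hn0, one_smul]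
  have h0 : ∑ i, (D i - μ) = 0 := by
    rw [Finset.sum_sub_distrib, hnμ]
    simp [← Nat.cast_smul_eq_nsmul ℝ]
  have hvS : ∀ S, ‖v S - Fg x‖ ^ 2 = (b : ℝ)⁻¹ ^ 2 * ‖∑ i ∈ S.1, (D i - μ)‖ ^ 2 := by
    intro S
    have hc : S.1.card = b := Finset.mem_powersetCard_univ.1 S.2
    have : v S - Fg x = (b : ℝ)⁻¹ • ∑ i ∈ S.1, (D i - μ) := by
      rw [hv, Finset.sum_sub_distrib D, Finset.sum_const, hc, ← Nat.cast_smul_eq_nsmul ℝ, smul_sub,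
        smul_smul, inv_mul_cancel₀ hb0, one_smul, hμF]
      abel
    rw [this, norm_smul, mul_pow, Real.norm_eq_abs, sq_abs]
  simp_rw [hvS]
  rw [← Finset.mul_sum, sum_sub (fun S => ‖∑ i ∈ S, (D i - μ)‖ ^ 2), sample_sq hn hb _ h0]
  have hle : ∑ i, ‖D i - μ‖ ^ 2 ≤ n * B := by
    refine le_trans ?_ hB
    have e : ∑ i, ‖D i - μ‖ ^ 2 = ∑ i, ‖D i‖ ^ 2 - n * ‖μ‖ ^ 2 := by
      simp only [norm_sub_sq_real, Finset.sum_add_distrib, Finset.sum_sub_distrib,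
        ← Finset.mul_sum, ← sum_inner, hnμ, inner_smul_left, real_inner_self_eq_norm_sq]
      simp
      ring
    rw [e]
    have : 0 ≤ (n : ℝ) * ‖μ‖ ^ 2 := by positivity
    linarith
  have hc : 0 ≤ (b : ℝ)⁻¹ ^ 2 * ((b : ℝ) * ((n : ℝ) - b) * (n.choose b : ℝ)
      / (n * ((n : ℝ) - 1))) := by
    have : 0 ≤ (n : ℝ) - b := by linarith
    have : 0 ≤ (n : ℝ) - 1 := by linarith
    positivity
  rw [← mul_assoc]
  refine (mul_le_mul_of_nonneg_left hle hc).trans (le_of_eq ?_)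
  field_simp

lemma step {n b : ℕ} (hn : 2 ≤ n) (hb : 1 ≤ b) (hbn : b ≤ n) {L : ℝ} (hL : 0 < L)
    {f : Fin n → H → ℝ} {f' : Fin n → H → H}
    (hgrad : ∀ i x, HasGradientAt (f i) (f' i x) x) (hconv : ∀ i, ConvexOn ℝ Set.univ (f i))
    (hsmooth : ∀ i x y, ‖f' i x - f' i y‖ ≤ L * ‖x - y‖)
    {F : H → ℝ} (hF : F = fun x => (n : ℝ)⁻¹ * ∑ i, f i x)
    {Fg : H → H} (hFg : Fg = fun x => (n : ℝ)⁻¹ • ∑ i, f' i x)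
    {xstar : H} (hmin : ∀ y, F xstar ≤ F y) {d : H → ℝ} {dg : H → H}
    (hdsc : ∀ x y, d y ≥ d x + ⟪dg x, y - x⟫ + (1 / 2) * ‖y - x‖ ^ 2)
    {V : H → H → ℝ} (hV : ∀ x y, V x y = d y - d x - ⟪dg x, y - x⟫)
    {a t δ : ℝ} (ha : 0 < a) (ht : t ∈ Set.Ioc (0 : ℝ) 1)
    (hδ : δ = ((n : ℝ) - b) / (b * ((n : ℝ) - 1)))
    (x y0 y z : H) (hx : x = (1 - t) • y + t • z)
    (I : Fintype {S : Finset (Fin n) // S ∈ Finset.powersetCard b Finset.univ})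
    (v yp zp : {S : Finset (Fin n) // S ∈ Finset.powersetCard b Finset.univ} → H)
    (hv : ∀ S, v S = (b : ℝ)⁻¹ • (∑ i ∈ S.1, (f' i x - f' i y0)) + Fg y0)
    (hy : ∀ S, yp S = x - L⁻¹ • v S) (hz : ∀ S, dg (zp S) = dg z - a • v S) :
    ∑ S, (a * (t⁻¹ - (1 + 4 * δ) * L * a) * (F x - F xstar)
      + L * a ^ 2 * (F (yp S) - F xstar) - V z xstar + V (zp S) xstar
      - a * (1 - t) / t * (F y - F xstar) - 4 * L * (a ^ 2 * δ) * (F y0 - F xstar)) ≤ 0 := by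
  have ht0 := ht.1
  have hmean := v_mean hn hb hFg x y0 v hv
  have hvar := v_var hn hb hbn hFg x y0 v hv
    (grad_diff_bound hn hL hgrad hconv hsmooth hF hFg hmin x y0)
  rw [← hδ] at hvar
  set N : ℝ := (n.choose b : ℝ)
  set g := Fg x with hg
  -- pointwise bound
  have hpt : ∀ S, a * (t⁻¹ - (1 + 4 * δ) * L * a) * (F x - F xstar)
      + L * a ^ 2 * (F (yp S) - F xstar) - V z xstar + V (zp S) xstar
      - a * (1 - t) / t * (F y - F xstar) - 4 * L * (a ^ 2 * δ) * (F y0 - F xstar)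
      ≤ a ^ 2 * (‖v S - g‖ ^ 2 - δ * (4 * L * ((F x - F xstar) + (F y0 - F xstar))))
        + (a ^ 2 * ⟪g, v S - g⟫ - a * ⟪z - xstar, v S - g⟫) := by
    intro S
    have h1 := mirror_step hdsc hV z (zp S) (v S) xstar a (hz S)
    have h2 := F_descent hn hgrad hsmooth hF hFg x (yp S)
    rw [hy S, sub_sub_cancel_left, inner_neg_right, inner_smul_right, norm_neg, norm_smul, mul_pow,
      Real.norm_eq_abs, sq_abs, ← hg, ← hy S] at h2
    have h2' : L * F (yp S) ≤ L * F x - ⟪g, v S⟫ + ‖v S‖ ^ 2 / 2 := by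
      have := mul_le_mul_of_nonneg_left h2 hL.le
      refine this.trans (le_of_eq ?_)
      field_simp
      ring
    have h3 := F_lower hn hgrad hconv hF hFg x xstar
    have h4 := F_lower hn hgrad hconv hF hFg x y
    rw [← hg] at h3 h4
    have hzx : t • (z - xstar) = t • (x - xstar) + (1 - t) • (x - y) := by
      rw [hx]; module
    have h5 : t * ⟪g, z - xstar⟫ = - (t * ⟪g, xstar - x⟫) - (1 - t) * ⟪g, y - x⟫ := by
      rw [← inner_smul_right, hzx, inner_add_right, inner_smul_right, inner_smul_right,
        ← neg_sub x xstar, ← neg_sub x y, inner_neg_right, inner_neg_right]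
      ring
    have h6 : t⁻¹ * (F x - F xstar) - (1 - t) / t * (F y - F xstar) ≤ ⟪g, z - xstar⟫ := by
      have h7 : (F x - F xstar) - (1 - t) * (F y - F xstar) ≤ t * ⟪g, z - xstar⟫ := by
        rw [h5]
        have p1 := mul_le_mul_of_nonneg_left h3 ht0.le
        have p2 := mul_le_mul_of_nonneg_left h4 (sub_nonneg.2 ht.2)
        linarith
      have h8 := mul_le_mul_of_nonneg_left h7 (inv_nonneg.2 ht0.le)
      rw [inv_mul_cancel_left₀ ht0.ne'] at h8
      refine le_trans (le_of_eq ?_) h8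
      rw [div_eq_mul_inv]; ring
    have h6' := mul_le_mul_of_nonneg_left h6 ha.le
    have h2a := mul_le_mul_of_nonneg_left h2' (sq_nonneg a)
    have n1 : ‖v S - g‖ ^ 2 = ‖v S‖ ^ 2 - 2 * ⟪g, v S⟫ + ‖g‖ ^ 2 := by
      rw [norm_sub_sq_real, real_inner_comm]
    have n2 : ⟪g, v S - g⟫ = ⟪g, v S⟫ - ‖g‖ ^ 2 := by
      rw [inner_sub_right, real_inner_self_eq_norm_sq]
    have n3 : ⟪z - xstar, v S - g⟫ = ⟪v S, z - xstar⟫ - ⟪g, z - xstar⟫ := by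
      rw [inner_sub_right, real_inner_comm, real_inner_comm g]
    rw [n1, n2, n3]
    have e1 : a * (t⁻¹ * (F x - F xstar) - (1 - t) / t * (F y - F xstar))
      = a * t⁻¹ * (F x - F xstar) - a * (1 - t) / t * (F y - F xstar) := by ring
    rw [e1] at h6'
    linarith
  refine (Finset.sum_le_sum fun S _ => hpt S).trans ?_
  have hzero : ∑ S, (v S - g) = 0 := by
    rw [Finset.sum_sub_distrib, hmean]
    simp only [Finset.sum_const, Finset.card_univ, card_sub]
    rw [← Nat.cast_smul_eq_nsmul ℝ, sub_self]
  have q1 : ∑ S, a ^ 2 * ⟪g, v S - g⟫ = 0 := by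
    rw [← Finset.mul_sum, ← inner_sum, hzero, inner_zero_right, mul_zero]
  have q2 : ∑ S, a * ⟪z - xstar, v S - g⟫ = 0 := by
    rw [← Finset.mul_sum, ← inner_sum, hzero, inner_zero_right, mul_zero]
  rw [Finset.sum_add_distrib, Finset.sum_sub_distrib (fun S => a ^ 2 * ⟪g, v S - g⟫), q1, q2,
    ← Finset.mul_sum, Finset.sum_sub_distrib]
  simp only [Finset.sum_const, Finset.card_univ, card_sub, nsmul_eq_mul, inner_zero_right, mul_zero, sub_zero, add_zero]
  have := mul_le_mul_of_nonneg_left (sub_nonpos.2 hvar) (sq_nonneg a)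
  linarith

end Step

lemma card_ne (Ω : Type*) (I : Fintype Ω) (h : Nonempty Ω) : (Fintype.card Ω : ℝ) ≠ 0 :=
  Nat.cast_ne_zero.2 Fintype.card_ne_zero

lemma sum_const_any {Ω : Type*} (I : Fintype Ω) (c : ℝ) :
    ∑ _ω : Ω, c = (Fintype.card Ω : ℝ) * c := by
  simp

lemma sum_update {ι : Type*} [Fintype ι] [DecidableEq ι] {A : ι → Type*}
    (J : ∀ i, Fintype (A i))
    (k : ι) (h : (∀ i, A i) → ℝ) (hle : ∀ ω, ∑ s, h (Function.update ω k s) ≤ 0)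
    : ∑ ω, h ω ≤ 0 := by
  rcases isEmpty_or_nonempty (∀ i, A i) with he | hne
  · simp
  have h1 : ∑ ω, ∑ s, h (Function.update ω k s) = Fintype.card (A k) * ∑ ω, h ω := by
    rw [← Fintype.sum_prod_type' (f := fun ω s => h (Function.update ω k s))]
    have : ∑ p : (∀ i, A i) × A k, h (Function.update p.1 k p.2)
        = ∑ p : (∀ i, A i) × A k, h p.1 := by
      refine Finset.sum_nbij' (fun p => (Function.update p.1 k p.2, p.1 k))
        (fun p => (Function.update p.1 k p.2, p.1 k)) ?_ ?_ ?_ ?_ ?_ <;> simp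
    rw [this, Fintype.sum_prod_type]
    simp [Finset.mul_sum]
  have hpos : (0 : ℝ) < Fintype.card (A k) := by
    obtain ⟨ω⟩ := hne
    exact_mod_cast Fintype.card_pos_iff.2 ⟨ω k⟩
  have h2 : ∑ ω, ∑ s, h (Function.update ω k s) ≤ 0 := Finset.sum_nonpos fun ω _ => hle ω
  rw [h1] at h2
  by_contra hh
  push Not at hh
  have := mul_pos hpos hh
  linarith

lemma telescope (L : ℝ) (α τ δ A B W : ℕ → ℝ) (m : ℕ)
    (h : ∀ k ≤ m, α (k + 1) * ((τ k)⁻¹ - (1 + 4 * δ (k + 1)) * L * α (k + 1)) * A (k + 1)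
      + L * α (k + 1) ^ 2 * B (k + 1) - W k + W (k + 1)
      - α (k + 1) * (1 - τ k) / τ k * B k - 4 * L * (α (k + 1) ^ 2 * δ (k + 1)) * B 0 ≤ 0) :
    (∑ k ∈ Finset.range (m + 1),
        α (k + 1) * ((τ k)⁻¹ - (1 + 4 * δ (k + 1)) * L * α (k + 1)) * A (k + 1)) +
      L * α (m + 1) ^ 2 * B (m + 1) + W (m + 1) ≤
    W 0 + (∑ k ∈ Finset.Icc 1 m, (α (k + 1) * (1 - τ k) / τ k - L * α k ^ 2) * B k) +
      (α 1 * (1 - τ 0) / τ 0 +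
        4 * L * ∑ k ∈ Finset.range (m + 1), α (k + 1) ^ 2 * δ (k + 1)) * B 0 := by
  induction m with
  | zero =>
    have := h 0 le_rfl
    simp at this ⊢
    linarith
  | succ m ih =>
    have h1 := ih fun k hk => h k (by omega)
    have h2 := h (m + 1) le_rfl
    rw [Finset.sum_range_succ, Finset.sum_range_succ (fun k => α (k + 1) ^ 2 * δ (k + 1)),
      Finset.sum_Icc_succ_top (by omega)]
    linarith

end AMSVRG

/-- **Lemma 2 (key lemma for Algorithm 1 of AMSVRG).**
Each `f i : ℝ^d → ℝ` is convex and `L`-smooth, `n ≥ 2`, `f = (1/n) Σ f i` has minimizer `x*`;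
`d` is differentiable and `1`-strongly convex with Bregman divergence `V`. The sample space
`Ω` is the product, over `k = 1, …, m+1`, of the sets of size-`b k` subsets of `{1,…,n}`,
with the uniform measure; `E` is the corresponding average. Starting from `y₀, z₀`, for
`ω ∈ Ω` the iterates satisfy `x_{k+1} = (1−τ_k) y_k + τ_k z_k`,
`v_{k+1} = (1/b_{k+1}) Σ_{i ∈ ω_{k+1}} (∇f_i(x_{k+1}) − ∇f_i(y₀)) + ∇f(y₀)`,
`y_{k+1} = x_{k+1} − (1/L) v_{k+1}`, and `∇d(z_{k+1}) = ∇d(z_k) − α_{k+1} v_{k+1}`. Then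
`Σ_{k=0}^m α_{k+1} (1/τ_k − (1+4δ_{k+1}) L α_{k+1}) E[f(x_{k+1}) − f(x*)]
   + L α_{m+1}² E[f(y_{m+1}) − f(x*)]
 ≤ V_{z₀}(x*) + Σ_{k=1}^m (α_{k+1}(1−τ_k)/τ_k − L α_k²) E[f(y_k) − f(x*)]
   + (α_1 (1−τ_0)/τ_0 + 4L Σ_{k=0}^m α_{k+1}² δ_{k+1}) (f(y₀) − f(x*))`. -/
theorem amsvrg_key_lemma {dd : ℕ} (n : ℕ) (hn : 2 ≤ n) (L : ℝ) (hL : 0 < L)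
    (f : Fin n → EuclideanSpace ℝ (Fin dd) → ℝ)
    (f' : Fin n → EuclideanSpace ℝ (Fin dd) → EuclideanSpace ℝ (Fin dd))
    (hgrad : ∀ i x, HasGradientAt (f i) (f' i x) x)
    (hconv : ∀ i, ConvexOn ℝ Set.univ (f i))
    (hsmooth : ∀ i x y, ‖f' i x - f' i y‖ ≤ L * ‖x - y‖)
    (F : EuclideanSpace ℝ (Fin dd) → ℝ)
    (hF : F = fun x => (n : ℝ)⁻¹ * ∑ i, f i x)
    (Fg : EuclideanSpace ℝ (Fin dd) → EuclideanSpace ℝ (Fin dd))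
    (hFg : Fg = fun x => (n : ℝ)⁻¹ • ∑ i, f' i x)
    (xstar : EuclideanSpace ℝ (Fin dd)) (hmin : ∀ y, F xstar ≤ F y)
    (d : EuclideanSpace ℝ (Fin dd) → ℝ)
    (dg : EuclideanSpace ℝ (Fin dd) → EuclideanSpace ℝ (Fin dd))
    (hdgrad : ∀ x, HasGradientAt d (dg x) x)
    (hdsc : ∀ x y, d y ≥ d x + ⟪dg x, y - x⟫ + (1 / 2) * ‖y - x‖ ^ 2)
    (V : EuclideanSpace ℝ (Fin dd) → EuclideanSpace ℝ (Fin dd) → ℝ)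
    (hV : ∀ x y, V x y = d y - d x - ⟪dg x, y - x⟫)
    (m : ℕ) (α : ℕ → ℝ) (hα : ∀ k ≤ m, 0 < α (k + 1))
    (τ : ℕ → ℝ) (hτ : ∀ k ≤ m, τ k ∈ Set.Ioc (0 : ℝ) 1)
    (b : ℕ → ℕ) (hb : ∀ k ≤ m, 1 ≤ b (k + 1) ∧ b (k + 1) ≤ n)
    (δ : ℕ → ℝ) (hδ : ∀ k, δ k = ((n : ℝ) - b k) / (b k * ((n : ℝ) - 1)))
    (y0 z0 : EuclideanSpace ℝ (Fin dd))
    -- the iterates, as functions of the sample point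
    (x y z v : ((k : Fin (m + 1)) →
        {S : Finset (Fin n) // S ∈ Finset.powersetCard (b (k.1 + 1)) Finset.univ}) →
      ℕ → EuclideanSpace ℝ (Fin dd))
    (hy0 : ∀ ω, y ω 0 = y0) (hz0 : ∀ ω, z ω 0 = z0)
    (hx : ∀ ω, ∀ k ≤ m, x ω (k + 1) = (1 - τ k) • y ω k + τ k • z ω k)
    (hv : ∀ ω, ∀ k, ∀ hk : k ≤ m,
      v ω (k + 1) = (b (k + 1) : ℝ)⁻¹ •
          (∑ i ∈ (ω ⟨k, Nat.lt_succ_of_le hk⟩ : Finset (Fin n)),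
            (f' i (x ω (k + 1)) - f' i y0)) + Fg y0)
    (hy : ∀ ω, ∀ k ≤ m, y ω (k + 1) = x ω (k + 1) - L⁻¹ • v ω (k + 1))
    (hz : ∀ ω, ∀ k ≤ m, dg (z ω (k + 1)) = dg (z ω k) - α (k + 1) • v ω (k + 1))
    -- the expectation over the uniform product measure
    (E : (((k : Fin (m + 1)) →
        {S : Finset (Fin n) // S ∈ Finset.powersetCard (b (k.1 + 1)) Finset.univ}) → ℝ) → ℝ)
    (hE : ∀ g, E g = (Fintype.card ((k : Fin (m + 1)) →
        {S : Finset (Fin n) // S ∈ Finset.powersetCard (b (k.1 + 1)) Finset.univ}) : ℝ)⁻¹ *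
      ∑ ω, g ω) :
    (∑ k ∈ Finset.range (m + 1),
        α (k + 1) * ((τ k)⁻¹ - (1 + 4 * δ (k + 1)) * L * α (k + 1)) *
          E (fun ω => F (x ω (k + 1)) - F xstar)) +
      L * α (m + 1) ^ 2 * E (fun ω => F (y ω (m + 1)) - F xstar) ≤
    V z0 xstar +
      (∑ k ∈ Finset.Icc 1 m,
        (α (k + 1) * (1 - τ k) / τ k - L * α k ^ 2) * E (fun ω => F (y ω k) - F xstar)) +
      (α 1 * (1 - τ 0) / τ 0 +
        4 * L * ∑ k ∈ Finset.range (m + 1), α (k + 1) ^ 2 * δ (k + 1)) *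
        (F y0 - F xstar) := by
  classical
  have caus : ∀ ω ω' (k : ℕ), k ≤ m + 1 → (∀ j : Fin (m + 1), j.1 < k → ω j = ω' j) →
      y ω k = y ω' k ∧ z ω k = z ω' k := by
    intro ω ω' k
    induction k with
    | zero => intro _ _; simp [hy0, hz0]
    | succ k ih =>
      intro hk hag
      have hkm : k ≤ m := by omega
      obtain ⟨i1, i2⟩ := ih (by omega) fun j hj => hag j (by omega)
      have ex : x ω (k + 1) = x ω' (k + 1) := by rw [hx _ _ hkm, hx _ _ hkm, i1, i2]
      have ev : v ω (k + 1) = v ω' (k + 1) := by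
        rw [hv _ _ hkm, hv _ _ hkm, ex, hag ⟨k, Nat.lt_succ_of_le hkm⟩ (Nat.lt_succ_self k)]
      refine ⟨by rw [hy _ _ hkm, hy _ _ hkm, ex, ev], ?_⟩
      apply AMSVRG.dg_inj hdsc
      rw [hz _ _ hkm, hz _ _ hkm, i2, ev]
  have hcard : (Fintype.card ((k : Fin (m + 1)) →
        {S : Finset (Fin n) // S ∈ Finset.powersetCard (b (k.1 + 1)) Finset.univ}) : ℝ) ≠ 0 := by
    have : Nonempty ((k : Fin (m + 1)) →
        {S : Finset (Fin n) // S ∈ Finset.powersetCard (b (k.1 + 1)) Finset.univ}) := by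
      refine ⟨fun k => Classical.choice ?_⟩
      have hbk := (hb k.1 (Nat.lt_succ_iff.1 k.2)).2
      obtain ⟨S, hS⟩ := (Finset.powersetCard_nonempty (n := b (k.1 + 1))
        (s := (Finset.univ : Finset (Fin n)))).2 (by simpa using hbk)
      exact ⟨⟨S, hS⟩⟩
    exact AMSVRG.card_ne _ _ this
  have Econst : ∀ c : ℝ, E (fun _ => c) = c := by
    intro c
    rw [hE, AMSVRG.sum_const_any, inv_mul_cancel_left₀ hcard]
  have Eadd : ∀ g h, E (fun ω => g ω + h ω) = E g + E h := by
    intro g h; simp only [hE, Finset.sum_add_distrib, mul_add]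
  have Esub : ∀ g h, E (fun ω => g ω - h ω) = E g - E h := by
    intro g h; simp only [hE, Finset.sum_sub_distrib, mul_sub]
  have Emul : ∀ (c : ℝ) g, E (fun ω => c * g ω) = c * E g := by
    intro c g; simp only [hE, ← Finset.mul_sum]; ring
  have hstep : ∀ k ≤ m, E (fun ω =>
      α (k + 1) * ((τ k)⁻¹ - (1 + 4 * δ (k + 1)) * L * α (k + 1)) * (F (x ω (k + 1)) - F xstar)
      + L * α (k + 1) ^ 2 * (F (y ω (k + 1)) - F xstar) - V (z ω k) xstar
      + V (z ω (k + 1)) xstar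
      - α (k + 1) * (1 - τ k) / τ k * (F (y ω k) - F xstar)
      - 4 * L * (α (k + 1) ^ 2 * δ (k + 1)) * (F y0 - F xstar)) ≤ 0 := by
    intro k hk
    rw [hE]
    refine mul_nonpos_of_nonneg_of_nonpos (by positivity) ?_
    refine AMSVRG.sum_update _ (⟨k, Nat.lt_succ_of_le hk⟩ : Fin (m + 1)) _ fun ω => ?_
    have hyz : ∀ S, y (Function.update ω ⟨k, Nat.lt_succ_of_le hk⟩ S) k = y ω k ∧
        z (Function.update ω ⟨k, Nat.lt_succ_of_le hk⟩ S) k = z ω k := by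
      intro S
      refine caus _ _ k (by omega) fun j hj => ?_
      rw [Function.update_of_ne]
      intro hjk
      rw [hjk] at hj
      exact lt_irrefl _ hj
    have hxx : ∀ S, x (Function.update ω ⟨k, Nat.lt_succ_of_le hk⟩ S) (k + 1) = x ω (k + 1) := by
      intro S; rw [hx _ _ hk, hx _ _ hk, (hyz S).1, (hyz S).2]
    simp only [hxx, (hyz _).1, (hyz _).2]
    refine AMSVRG.step hn (hb k hk).1 (hb k hk).2 hL hgrad hconv hsmooth hF hFg hmin hdsc hV
      (hα k hk) (hτ k hk) (hδ (k + 1)) (x ω (k + 1)) y0 (y ω k) (z ω k) (hx _ _ hk) _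
      (fun S => v (Function.update ω ⟨k, Nat.lt_succ_of_le hk⟩ S) (k + 1))
      (fun S => y (Function.update ω ⟨k, Nat.lt_succ_of_le hk⟩ S) (k + 1))
      (fun S => z (Function.update ω ⟨k, Nat.lt_succ_of_le hk⟩ S) (k + 1)) ?_ ?_ ?_
    · intro S
      simp only [hv _ _ hk, hxx, Function.update_self]
    · intro S
      simp only [hy _ _ hk, hxx]
    · intro S
      simp only [hz _ _ hk, (hyz _).2]
  have htel := AMSVRG.telescope L α τ δ (fun k => E fun ω => F (x ω k) - F xstar)
    (fun k => E fun ω => F (y ω k) - F xstar) (fun k => E fun ω => V (z ω k) xstar) m (by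
      intro k hk
      have := hstep k hk
      simp only [Eadd, Esub, Emul, Econst] at this
      simp only [hy0, Econst, Esub]
      exact this)
  simp only [hy0, hz0, Econst] at htel
  have hW : 0 ≤ E (fun ω => V (z ω (m + 1)) xstar) := by
    rw [hE]
    refine mul_nonneg (by positivity) (Finset.sum_nonneg fun ω _ => ?_)
    rw [hV]
    have := hdsc (z ω (m + 1)) xstar
    nlinarith [sq_nonneg ‖xstar - z ω (m + 1)‖]
  linarith
end

section
/- (Theorem 1, second bound.) In the setting of Theorem 1 (Algorithm 1 with η = 1/L, α_{k+1} = (k+2)/(4L), 1/τ_k = L·α_{k+1} + 1/2, p ∈ (0,1/2], and 4L·δ_{k+1}·α_{k+1} ≤ p for all k ≤ m), suppose additionally f(y_0) > f(x*) and let q > 0. If m ≥ 4·√( L·V_{z_0}(x*) / ( q·( f(y_0) − f(x*) ) ) ), then E[ f(y_{m+1}) − f(x*) ] ≤ ( q + (5/2)·p )·( f(y_0) − f(x*) ). -/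
open RealInnerProductSpace

section
variable {E : Type*} [NormedAddCommGroup E] [InnerProductSpace ℝ E] [CompleteSpace E]

lemma line_deriv {f : E → ℝ} {f' : E → E} (h : ∀ x, HasGradientAt f (f' x) x) (x w : E) (t : ℝ) :
    HasDerivAt (fun t : ℝ => f (x + t • w)) ⟪f' (x + t • w), w⟫ t := by
  have h1 := (h (x + t • w)).hasFDerivAt
  have h2 : HasDerivAt (fun t : ℝ => x + t • w) w t := by
    simpa using ((hasDerivAt_id t).smul_const w).const_add x
  have := h1.comp_hasDerivAt t h2
  exact this.congr_deriv (by simp)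

lemma grad_ineq {f : E → ℝ} {f' : E → E} (h : ∀ x, HasGradientAt f (f' x) x)
    (hc : ConvexOn ℝ Set.univ f) (x y : E) : f x + ⟪f' x, y - x⟫ ≤ f y := by
  have hd := line_deriv h x (y - x) 0
  have hg : ConvexOn ℝ Set.univ (fun t : ℝ => f (x + t • (y - x))) := by
    refine ⟨convex_univ, fun s _ t _ a b ha hb hab => ?_⟩
    have := hc.2 (Set.mem_univ (x + s • (y - x))) (Set.mem_univ (x + t • (y - x))) ha hb hab
    obtain rfl : a = 1 - b := by linarith
    have e : x + ((1 - b) * s + b * t) • (y - x)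
        = (1 - b) • (x + s • (y - x)) + b • (x + t • (y - x)) := by module
    show f (x + ((1 - b) * s + b * t) • (y - x)) ≤ _
    rw [e]; exact this
  have := hg.le_slope_of_hasDerivAt (Set.mem_univ 0) (Set.mem_univ 1) one_pos hd
  simp [slope] at this
  linarith

lemma descent {f : E → ℝ} {f' : E → E} (h : ∀ x, HasGradientAt f (f' x) x) {L : ℝ}
    (hs : ∀ x y, ‖f' x - f' y‖ ≤ L * ‖x - y‖) (x y : E) :
    f y ≤ f x + ⟪f' x, y - x⟫ + L / 2 * ‖y - x‖ ^ 2 := by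
  set w := y - x with hw
  have hd : ∀ t : ℝ, HasDerivAt (fun t : ℝ => f (x + t • w) - t * ⟪f' x, w⟫ - L / 2 * ‖w‖ ^ 2 * t ^ 2)
      (⟪f' (x + t • w), w⟫ - ⟪f' x, w⟫ - L * t * ‖w‖ ^ 2) t := by
    intro t
    have h1 := ((line_deriv h x w t).sub ((hasDerivAt_id t).mul_const ⟪f' x, w⟫)).sub
      ((hasDerivAt_pow 2 t).const_mul (L / 2 * ‖w‖ ^ 2))
    exact h1.congr_deriv (by simp; ring)
  have := antitoneOn_of_deriv_nonpos (convex_Icc (0:ℝ) 1)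
    (f := fun t : ℝ => f (x + t • w) - t * ⟪f' x, w⟫ - L / 2 * ‖w‖ ^ 2 * t ^ 2)
    (fun t _ => (hd t).continuousAt.continuousWithinAt)
    (fun t _ => (hd t).differentiableAt.differentiableWithinAt) (by
      intro t ht
      rw [interior_Icc] at ht
      rw [(hd t).deriv, ← inner_sub_left]
      have a1 := real_inner_le_norm (f' (x + t • w) - f' x) w
      have a2 := hs (x + t • w) x
      rw [add_sub_cancel_left, norm_smul, Real.norm_eq_abs, abs_of_pos ht.1] at a2
      have a3 := mul_le_mul_of_nonneg_right a2 (norm_nonneg w)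
      nlinarith)
  have h01 := this (Set.left_mem_Icc.2 zero_le_one) (Set.right_mem_Icc.2 zero_le_one) zero_le_one
  simp [hw] at h01
  simp [hw]
  linarith

lemma cocoercive {f : E → ℝ} {f' : E → E} (h : ∀ x, HasGradientAt f (f' x) x)
    (hc : ConvexOn ℝ Set.univ f) {L : ℝ} (hL : 0 < L)
    (hs : ∀ x y, ‖f' x - f' y‖ ≤ L * ‖x - y‖) (x y : E) :
    ‖f' y - f' x‖ ^ 2 ≤ 2 * L * (f y - f x - ⟪f' x, y - x⟫) := by
  have h1 := grad_ineq h hc x (y - L⁻¹ • (f' y - f' x))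
  have h2 := descent h hs y (y - L⁻¹ • (f' y - f' x))
  set w := f' y - f' x with hw
  have e1 : y - L⁻¹ • w - x = (y - x) - L⁻¹ • w := by abel
  have e2 : y - L⁻¹ • w - y = - (L⁻¹ • w) := by abel
  rw [e1, inner_sub_right, real_inner_smul_right] at h1
  rw [e2, inner_neg_right, real_inner_smul_right, norm_neg, norm_smul, mul_pow, Real.norm_eq_abs, sq_abs] at h2
  have e3 : ‖w‖ ^ 2 = ⟪f' y, w⟫ - ⟪f' x, w⟫ := by
    rw [← inner_sub_left, ← hw, real_inner_self_eq_norm_sq]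
  have e4 : L / 2 * (L⁻¹ ^ 2 * ‖w‖ ^ 2) = L⁻¹ * ‖w‖ ^ 2 / 2 := by field_simp
  have e5 : L⁻¹ * ‖w‖ ^ 2 = L⁻¹ * ⟪f' y, w⟫ - L⁻¹ * ⟪f' x, w⟫ := by rw [e3]; ring
  have : L⁻¹ * ‖w‖ ^ 2 ≤ 2 * (f y - f x - ⟪f' x, y - x⟫) := by linarith
  have := mul_le_mul_of_nonneg_left this hL.le
  rw [← mul_assoc, mul_inv_cancel₀ hL.ne', one_mul] at this
  linarith
end

section
open Finset
variable {n : ℕ}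

lemma cnt_out (b : ℕ) (T : Finset (Fin n)) :
    #{S ∈ powersetCard b (univ : Finset (Fin n)) | Disjoint T S} = (n - #T).choose b := by
  have : {S ∈ powersetCard b (univ : Finset (Fin n)) | Disjoint T S} = powersetCard b Tᶜ := by
    ext S
    simp only [mem_filter, mem_powersetCard, subset_univ, true_and]
    rw [subset_compl_iff_disjoint_left, and_comm]
  rw [this, card_powersetCard, card_compl, Fintype.card_fin]

lemma cnt_in (b : ℕ) (i : Fin n) :
    (#{S ∈ powersetCard b (univ : Finset (Fin n)) | i ∈ S} : ℝ) = n.choose b - (n - 1).choose b := by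
  have h := card_filter_add_card_filter_not (s := powersetCard b (univ : Finset (Fin n))) (fun S => i ∈ S)
  have h2 := cnt_out b {i}
  simp only [disjoint_singleton_left, card_singleton] at h2
  rw [h2, card_powersetCard, card_univ, Fintype.card_fin] at h
  rw [← h]; push_cast; ring

lemma cnt_in_out (b : ℕ) (i j : Fin n) (hij : i ≠ j) :
    (#{S ∈ powersetCard b (univ : Finset (Fin n)) | i ∈ S ∧ j ∉ S} : ℝ)
      = (n - 1).choose b - (n - 2).choose b := by
  have h := card_filter_add_card_filter_not (s := {S ∈ powersetCard b (univ : Finset (Fin n)) | j ∉ S}) (fun S => i ∈ S)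
  have h2 := cnt_out b {j}
  have h3 := cnt_out b {i, j}
  simp only [disjoint_singleton_left, card_singleton, disjoint_insert_left, card_pair hij] at h2 h3
  rw [h2, filter_filter, filter_filter] at h
  have e1 : {S ∈ powersetCard b (univ : Finset (Fin n)) | j ∉ S ∧ i ∈ S} = {S ∈ powersetCard b (univ : Finset (Fin n)) | i ∈ S ∧ j ∉ S} := by
    simp only [and_comm]
  have e2 : {S ∈ powersetCard b (univ : Finset (Fin n)) | j ∉ S ∧ i ∉ S} = {S ∈ powersetCard b (univ : Finset (Fin n)) | i ∉ S ∧ j ∉ S} := by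
    simp only [and_comm]
  rw [e1, e2, h3] at h
  rw [← h]; push_cast; ring

/-- First moment, scalar weights. -/
lemma sum_in {M : Type*} [AddCommGroup M] [Module ℝ M] (b : ℕ) (a : Fin n → M) :
    ∑ S ∈ powersetCard b (univ : Finset (Fin n)), ∑ i ∈ S, a i
      = ((n.choose b : ℝ) - (n - 1).choose b) • ∑ i, a i := by
  have : ∀ S ∈ powersetCard b (univ : Finset (Fin n)), ∑ i ∈ S, a i = ∑ i, if i ∈ S then a i else 0 := by
    intro S _; simp
  rw [sum_congr rfl this, sum_comm, smul_sum]
  refine sum_congr rfl fun i _ => ?_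
  rw [← sum_filter, sum_const, ← cnt_in b i, Nat.cast_smul_eq_nsmul]

lemma sum_in_out (b : ℕ) (a : Fin n → Fin n → ℝ) :
    ∑ S ∈ powersetCard b (univ : Finset (Fin n)), ∑ i ∈ S, ∑ j ∈ Sᶜ, a i j
      = (((n-1).choose b : ℝ) - (n - 2).choose b) * ∑ i, ∑ j ∈ univ.erase i, a i j := by
  have : ∀ S ∈ powersetCard b (univ : Finset (Fin n)), ∑ i ∈ S, ∑ j ∈ Sᶜ, a i j
      = ∑ i, ∑ j ∈ univ.erase i, if i ∈ S ∧ j ∉ S then a i j else 0 := by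
    intro S _
    rw [← sum_filter_add_sum_filter_not univ (fun i => i ∈ S)]
    simp only [filter_mem_eq_inter, univ_inter]
    rw [sum_eq_zero (s := {x | x ∉ S}), add_zero]
    · refine sum_congr rfl fun i hi => ?_
      rw [← sum_filter]
      refine sum_congr ?_ fun _ _ => rfl
      ext j; simp [hi]
      rintro h rfl; exact h hi
    · intro i hi
      simp at hi
      simp [hi]
  rw [sum_congr rfl this, sum_comm, mul_sum]
  refine sum_congr rfl fun i _ => ?_
  rw [sum_comm, mul_sum]
  refine sum_congr rfl fun j hj => ?_
  rw [← sum_filter, sum_const, ← cnt_in_out b i j (ne_of_mem_erase hj).symm, nsmul_eq_mul]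

variable {E : Type*} [NormedAddCommGroup E] [InnerProductSpace ℝ E]

lemma mean_lem (hn : 2 ≤ n) (b : ℕ) (hb : 1 ≤ b) (a : Fin n → E) :
    ∑ S ∈ powersetCard b (univ : Finset (Fin n)), (b : ℝ)⁻¹ • ∑ i ∈ S, a i
      = (n.choose b : ℝ) • ((n : ℝ)⁻¹ • ∑ i, a i) := by
  have h1 := sum_in b (fun _ : Fin n => (1:ℝ))
  have : ∀ S ∈ powersetCard b (univ : Finset (Fin n)), ∑ i ∈ S, (1:ℝ) = b := by
    intro S hS; simp [(mem_powersetCard.1 hS).2]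
  rw [sum_congr rfl this] at h1
  simp at h1
  rw [← smul_sum, sum_in, smul_smul, smul_smul]
  congr 1
  have : (b:ℝ) ≠ 0 := by positivity
  have : (n:ℝ) ≠ 0 := by positivity
  field_simp
  linarith

lemma var_lem (hn : 2 ≤ n) (b : ℕ) (hb : 1 ≤ b) (hbn : b ≤ n) (a : Fin n → E) :
    ∑ S ∈ powersetCard b (univ : Finset (Fin n)), ‖(b : ℝ)⁻¹ • ∑ i ∈ S, a i - (n : ℝ)⁻¹ • ∑ i, a i‖ ^ 2
      ≤ (n.choose b : ℝ) * (((n:ℝ) - b) / (b * ((n:ℝ) - 1)) * ((n : ℝ)⁻¹ * ∑ i, ‖a i‖ ^ 2)) := by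
  have hbR : (b:ℝ) ≠ 0 := by positivity
  have hnR : (n:ℝ) ≠ 0 := by positivity
  have hn2 : (2:ℝ) ≤ n := by exact_mod_cast hn
  have hbn' : (b:ℝ) ≤ n := by exact_mod_cast hbn
  have hn1 : (n:ℝ) - 1 ≠ 0 := by linarith
  set M : ℝ := ((n-1).choose b : ℝ) - (n - 2).choose b with hM
  have hMid : (n.choose b : ℝ) * (b * (n - b)) = M * (n * (n - 1)) := by
    have h1 := sum_in_out b (fun _ _ : Fin n => (1:ℝ))
    have : ∀ S ∈ powersetCard b (univ : Finset (Fin n)), ∑ i ∈ S, ∑ j ∈ Sᶜ, (1:ℝ) = b * (n - b) := by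
      intro S hS
      simp [(mem_powersetCard.1 hS).2, card_compl, Nat.cast_sub hbn, mul_sub]
    rw [sum_congr rfl this] at h1
    simp at h1
    rw [h1, Nat.cast_sub (by omega)]; simp [hM]
  set abar := (n : ℝ)⁻¹ • ∑ i, a i with habar
  set c : Fin n → E := fun i => a i - abar with hc
  have hc0 : ∑ i, c i = 0 := by
    simp only [hc, sum_sub_distrib, sum_const, card_univ, Fintype.card_fin, habar]
    rw [← Nat.cast_smul_eq_nsmul ℝ, smul_smul, mul_inv_cancel₀ hnR, one_smul, sub_self]
  have hterm : ∀ S ∈ powersetCard b (univ : Finset (Fin n)),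
      ‖(b : ℝ)⁻¹ • ∑ i ∈ S, a i - abar‖ ^ 2 = ((b:ℝ)⁻¹)^2 * - ∑ i ∈ S, ∑ j ∈ Sᶜ, ⟪c i, c j⟫ := by
    intro S hS
    have e1 : (b : ℝ)⁻¹ • ∑ i ∈ S, a i - abar = (b : ℝ)⁻¹ • ∑ i ∈ S, c i := by
      simp only [hc, sum_sub_distrib, sum_const, (mem_powersetCard.1 hS).2]
      rw [← Nat.cast_smul_eq_nsmul ℝ, smul_sub, smul_smul, inv_mul_cancel₀ hbR, one_smul]
    have e2 : ∑ j ∈ Sᶜ, c j = - ∑ i ∈ S, c i := by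
      rw [eq_neg_iff_add_eq_zero, add_comm, sum_add_sum_compl, hc0]
    rw [e1, norm_smul, mul_pow, Real.norm_eq_abs, sq_abs]
    congr 1
    simp_rw [← inner_sum]
    rw [← sum_inner, e2, inner_neg_right, neg_neg, real_inner_self_eq_norm_sq]
  have hsum : ∑ i, ∑ j ∈ univ.erase i, ⟪c i, c j⟫ = - ∑ i, ‖c i‖ ^ 2 := by
    rw [← sum_neg_distrib]
    refine sum_congr rfl fun i _ => ?_
    rw [← inner_sum, ← sum_erase_add univ c (mem_univ i)] at *
    rw [eq_neg_of_add_eq_zero_left hc0, inner_neg_right, real_inner_self_eq_norm_sq]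
  rw [sum_congr rfl hterm, ← mul_sum, sum_neg_distrib, sum_in_out, hsum]
  have hle : ∑ i, ‖c i‖ ^ 2 ≤ ∑ i, ‖a i‖ ^ 2 := by
    have : ∑ i, ‖a i‖ ^ 2 = ∑ i, ‖c i‖ ^ 2 + n * ‖abar‖ ^ 2 := by
      have : ∀ i, ‖a i‖ ^ 2 = ‖c i‖ ^ 2 + 2 * ⟪c i, abar⟫ + ‖abar‖ ^ 2 := by
        intro i
        rw [← norm_add_sq_real]; simp [hc]
      simp_rw [this]
      rw [sum_add_distrib, sum_add_distrib, ← mul_sum, ← sum_inner, hc0]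
      simp
    rw [this]; have : 0 ≤ (n:ℝ) * ‖abar‖ ^ 2 := by positivity
    linarith
  have hMe : M = (n.choose b : ℝ) * (b * (n - b)) / (n * (n - 1)) := by
    rw [hMid]; field_simp
  rw [← hM]
  have : ((b:ℝ)⁻¹)^2 * M = (n.choose b : ℝ) * (((n:ℝ) - b) / (b * ((n:ℝ) - 1)) * (n : ℝ)⁻¹) := by
    rw [hMe]; field_simp
  have hnn : 0 ≤ (n.choose b : ℝ) * (((n:ℝ) - b) / (b * ((n:ℝ) - 1)) * (n : ℝ)⁻¹) := by
    have : 0 ≤ (n:ℝ) - b := by linarith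
    have : 0 ≤ (n:ℝ) - 1 := by linarith
    positivity
  calc _ = (((b:ℝ)⁻¹)^2 * M) * ∑ i, ‖c i‖ ^ 2 := by ring
    _ ≤ (((b:ℝ)⁻¹)^2 * M) * ∑ i, ‖a i‖ ^ 2 := by
        apply mul_le_mul_of_nonneg_left hle; rw [this]; exact hnn
    _ = _ := by rw [this]; ring
end

lemma mean_lem2 {n : ℕ} {E : Type*} [NormedAddCommGroup E] [InnerProductSpace ℝ E]
    (hn : 2 ≤ n) (b : ℕ) (hb : 1 ≤ b) (a : Fin n → E)
    [Fintype {S : Finset (Fin n) // S ∈ Finset.powersetCard b Finset.univ}] :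
    ∑ S : {S : Finset (Fin n) // S ∈ Finset.powersetCard b Finset.univ},
      (b : ℝ)⁻¹ • ∑ i ∈ (S : Finset (Fin n)), a i
      = (n.choose b : ℝ) • ((n : ℝ)⁻¹ • ∑ i, a i) := by
  rw [← mean_lem hn b hb a]
  exact (Finset.sum_subtype _ (fun _ => Iff.rfl)
    (fun S : Finset (Fin n) => (b : ℝ)⁻¹ • ∑ i ∈ S, a i)).symm

lemma var_lem2 {n : ℕ} {E : Type*} [NormedAddCommGroup E] [InnerProductSpace ℝ E]
    (hn : 2 ≤ n) (b : ℕ) (hb : 1 ≤ b) (hbn : b ≤ n) (a : Fin n → E)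
    [Fintype {S : Finset (Fin n) // S ∈ Finset.powersetCard b Finset.univ}] :
    ∑ S : {S : Finset (Fin n) // S ∈ Finset.powersetCard b Finset.univ},
      ‖(b : ℝ)⁻¹ • ∑ i ∈ (S : Finset (Fin n)), a i - (n : ℝ)⁻¹ • ∑ i, a i‖ ^ 2
      ≤ (n.choose b : ℝ) * (((n:ℝ) - b) / (b * ((n:ℝ) - 1)) * ((n : ℝ)⁻¹ * ∑ i, ‖a i‖ ^ 2)) := by
  refine le_trans (le_of_eq ?_) (var_lem hn b hb hbn a)
  exact (Finset.sum_subtype _ (fun _ => Iff.rfl)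
    (fun S : Finset (Fin n) => ‖(b : ℝ)⁻¹ • ∑ i ∈ S, a i - (n : ℝ)⁻¹ • ∑ i, a i‖ ^ 2)).symm

/-- averaging one coordinate of a finite product does not change the sum -/
lemma sum_update {ι : Type*} [Fintype ι] [DecidableEq ι] {A : ι → Type*}
    [Fintype (∀ i, A i)] (k : ι) [Fintype (A k)] (g : (∀ i, A i) → ℝ) :
    ∑ ω, ∑ s : A k, g (Function.update ω k s) = (Fintype.card (A k) : ℝ) * ∑ ω, g ω := by
  have : ∑ q : (∀ i, A i) × A k, g (Function.update q.1 k q.2) = ∑ q : (∀ i, A i) × A k, g q.1 := by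
    refine Finset.sum_bij' (fun q _ => (Function.update q.1 k q.2, q.1 k))
      (fun q _ => (Function.update q.1 k q.2, q.1 k)) ?_ ?_ ?_ ?_ ?_ <;> simp
  rw [Fintype.sum_prod_type, Fintype.sum_prod_type] at this
  rw [this]; simp [Finset.mul_sum]

section
variable {E : Type*} [NormedAddCommGroup E] [InnerProductSpace ℝ E]

lemma mirror {d : E → ℝ} {dg : E → E}
    (hdsc : ∀ x y, d y ≥ d x + ⟪dg x, y - x⟫ + (1 / 2) * ‖y - x‖ ^ 2)
    {V : E → E → ℝ} (hV : ∀ x y, V x y = d y - d x - ⟪dg x, y - x⟫)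
    (z z' w u : E) (hz : dg z' = dg z - w) :
    V z' u ≤ V z u - ⟪w, z - u⟫ + (1 / 2) * ‖w‖ ^ 2 := by
  have h1 := hdsc z z'
  rw [hV, hV, hz, inner_sub_left]
  have e1 : ⟪dg z, u - z⟫ = ⟪dg z, u - z'⟫ + ⟪dg z, z' - z⟫ := by
    rw [← inner_add_right]; congr 1; abel
  have e2 : ⟪w, z - u⟫ = - ⟪w, u - z'⟫ - ⟪w, z' - z⟫ := by
    rw [← inner_neg_right, ← inner_sub_right]; congr 1; abel
  have h2 : 0 ≤ ‖(z' - z) + w‖ ^ 2 := by positivity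
  rw [norm_add_sq_real, real_inner_comm] at h2
  linarith

lemma one_step {A : Type*} [Fintype A] (L α τ δ p D0 : ℝ) (hL : 0 < L) 
    (hτ : τ⁻¹ = L * α + 1 / 2) (hα : 1 / 2 ≤ L * α) (hp2 : p ≤ 1 / 2) (hD0 : 0 ≤ D0)
    (hp : 4 * L * δ * α ≤ p)
    {F : E → ℝ} {Fg : E → E} (hFc : ∀ x y, F x + ⟪Fg x, y - x⟫ ≤ F y)
    (hFd : ∀ x y, F y ≤ F x + ⟪Fg x, y - x⟫ + L / 2 * ‖y - x‖ ^ 2)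
    (xstar : E) (hmin : ∀ y, F xstar ≤ F y)
    {d : E → ℝ} {dg : E → E}
    (hdsc : ∀ x y, d y ≥ d x + ⟪dg x, y - x⟫ + (1 / 2) * ‖y - x‖ ^ 2)
    {V : E → E → ℝ} (hV : ∀ x y, V x y = d y - d x - ⟪dg x, y - x⟫)
    (x y z : E) (hx : x = (1 - τ) • y + τ • z) (v y' z' : A → E)
    (hmean : ∑ s, v s = (Fintype.card A : ℝ) • Fg x)
    (hvar : ∑ s, ‖v s - Fg x‖ ^ 2 ≤ (Fintype.card A : ℝ) * (4 * L * δ * (F x - F xstar + D0)))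
    (hy : ∀ s, y' s = x - L⁻¹ • v s) (hz : ∀ s, dg (z' s) = dg z - α • v s) :
    ∑ s, (L * α ^ 2 * (F (y' s) - F xstar) + V (z' s) xstar) ≤
      (Fintype.card A : ℝ) * ((L * α ^ 2 - α / 2) * (F y - F xstar) + V z xstar + α * p * D0) := by
  have hα0 : 0 < α := by
    by_contra h
    have : L * α ≤ 0 := mul_nonpos_of_nonneg_of_nonpos hL.le (not_lt.1 h)
    linarith
  set N := (Fintype.card A : ℝ) with hN
  have hN0 : 0 ≤ N := by positivity
  set g := Fg x with hg
  have hpt : ∀ s, L * α ^ 2 * (F (y' s) - F xstar) + V (z' s) xstar ≤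
      (L * α ^ 2 * (F x - F xstar) + V z xstar - α ^ 2 * ‖g‖ ^ 2) - α * ⟪v s, z - xstar⟫
        + α ^ 2 * ‖v s - g‖ ^ 2 + α ^ 2 * ⟪v s, g⟫ := by
    intro s
    have h1 := hFd x (y' s)
    have h2 := mirror hdsc hV z (z' s) (α • v s) xstar (hz s)
    have e1 : y' s - x = - (L⁻¹ • v s) := by rw [hy]; abel
    rw [e1, inner_neg_right, real_inner_smul_right, norm_neg, norm_smul, mul_pow,
      Real.norm_eq_abs, sq_abs, ← hg, real_inner_comm] at h1
    rw [real_inner_smul_left, norm_smul, mul_pow, Real.norm_eq_abs, sq_abs] at h2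
    rw [norm_sub_sq_real]
    have h3 := mul_le_mul_of_nonneg_left h1 (by positivity : 0 ≤ L * α ^ 2)
    have e2 : L * α ^ 2 * (F x + -(L⁻¹ * ⟪v s, g⟫) + L / 2 * (L⁻¹ ^ 2 * ‖v s‖ ^ 2)) =
      L * α ^ 2 * F x - α ^ 2 * ⟪v s, g⟫ + α ^ 2 / 2 * ‖v s‖ ^ 2 := by
      field_simp; ring
    rw [e2] at h3
    linarith
  have hsum := Finset.sum_le_sum (s := Finset.univ) (fun s _ => hpt s)
  refine hsum.trans ?_
  rw [Finset.sum_add_distrib, Finset.sum_add_distrib, Finset.sum_sub_distrib, ← Finset.mul_sum,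
    ← Finset.mul_sum, ← Finset.mul_sum, ← sum_inner, ← sum_inner, hmean, real_inner_smul_left,
    real_inner_smul_left, real_inner_self_eq_norm_sq, Finset.sum_const, Finset.card_univ,
    nsmul_eq_mul, ← hN]
  have hv2 := mul_le_mul_of_nonneg_left hvar (by positivity : 0 ≤ α ^ 2)
  have hDx : 0 ≤ F x - F xstar := by linarith [hmin x]
  -- convexity
  have c1 := hFc x xstar
  have c2 := hFc x y
  have hτ0 : τ ≠ 0 := by
    intro h; rw [h, inv_zero] at hτ; linarith
  have e3 : x - z = (L * α - 1 / 2) • (y - x) := by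
    have : L * α - 1 / 2 = τ⁻¹ - 1 := by rw [hτ]; ring
    rw [this]
    have : z = τ⁻¹ • (x - (1 - τ) • y) := by
      rw [hx, add_sub_cancel_left, smul_smul, inv_mul_cancel₀ hτ0, one_smul]
    have h4 : τ⁻¹ • (x - (1 - τ) • y) = τ⁻¹ • x - τ⁻¹ • y + y := by
      rw [smul_sub, smul_smul, mul_sub, inv_mul_cancel₀ hτ0]; module
    rw [this, h4]; module
  have e4 : ⟪g, z - xstar⟫ = - ((L * α - 1 / 2) * ⟪g, y - x⟫) - ⟪g, xstar - x⟫ := by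
    rw [← real_inner_smul_right, ← e3, ← inner_neg_right, ← inner_sub_right]; congr 1; abel
  have c3 := mul_le_mul_of_nonneg_left c2 (by linarith : 0 ≤ L * α - 1 / 2)
  have c4 : F x - F xstar - (L * α - 1 / 2) * (F y - F x) ≤ ⟪g, z - xstar⟫ := by
    rw [e4]; linarith
  have c5 := mul_le_mul_of_nonneg_left c4 hα0.le
  have c6 : α * (4 * L * δ * α) * (F x - F xstar + D0) ≤ α * p * (F x - F xstar + D0) := by
    gcongr
  have c7 : α * p * (F x - F xstar) ≤ α * (1 / 2) * (F x - F xstar) := by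
    gcongr
  have key : L * α ^ 2 * (F x - F xstar) + V z xstar - α * ⟪g, z - xstar⟫
      + α ^ 2 * (4 * L * δ * (F x - F xstar + D0)) ≤
      (L * α ^ 2 - α / 2) * (F y - F xstar) + V z xstar + α * p * D0 := by
    linarith
  have key2 := mul_le_mul_of_nonneg_left key hN0
  linarith
end

lemma final_arith {m : ℕ} {L p q V0 D0 T : ℝ} (hL : 0 < L) (hp : 0 < p) (hq : 0 < q) (hD : 0 < D0)
    (hV : 0 ≤ V0)
    (hm : 4 * Real.sqrt (L * V0 / (q * D0)) ≤ (m : ℝ))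
    (hT : ((m:ℝ) + 2) ^ 2 * T ≤ 16 * L * V0 + 2 * p * (m + 1) * (m + 4) * D0) :
    T ≤ (q + (5 / 2) * p) * D0 := by
  have h1 : 16 * (L * V0 / (q * D0)) ≤ (m:ℝ) ^ 2 := by
    have hs := Real.sq_sqrt (show 0 ≤ L * V0 / (q * D0) by positivity)
    have := pow_le_pow_left₀ (by positivity) hm 2
    rw [mul_pow, hs] at this
    linarith
  have h2 : 16 * L * V0 ≤ (m:ℝ) ^ 2 * (q * D0) := by
    have := mul_le_mul_of_nonneg_right h1 (by positivity : 0 ≤ q * D0)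
    have e : 16 * (L * V0 / (q * D0)) * (q * D0) = 16 * L * V0 := by field_simp
    linarith
  have hm0 : (0:ℝ) ≤ m := by positivity
  have hpD : 0 < p * D0 := by positivity
  have hqD : 0 < q * D0 := by positivity
  have : ((m:ℝ) + 2) ^ 2 * T ≤ ((m:ℝ) + 2) ^ 2 * ((q + (5 / 2) * p) * D0) := by
    nlinarith [mul_nonneg hm0 hqD.le, mul_nonneg (sq_nonneg (m:ℝ)) hpD.le, mul_nonneg hm0 hpD.le]
  exact le_of_mul_le_mul_left this (by positivity)

/-- **Theorem 1, second bound.**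
In the setting of Theorem 1 (Algorithm 1 of AMSVRG with `η = 1/L`, `α_{k+1} = (k+2)/(4L)`,
`1/τ_k = L α_{k+1} + 1/2`, `p ∈ (0,1/2]`, and `4 L δ_{k+1} α_{k+1} ≤ p` for all `k ≤ m`),
suppose additionally `f(y₀) > f(x*)` and let `q > 0`. If
`m ≥ 4 √(L V_{z₀}(x*) / (q (f(y₀) − f(x*))))`, then
`E[f(y_{m+1}) − f(x*)] ≤ (q + (5/2) p) (f(y₀) − f(x*))`. -/
theorem amsvrg_theorem1_second_bound {dd : ℕ} (n : ℕ) (hn : 2 ≤ n) (L : ℝ) (hL : 0 < L)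
    (f : Fin n → EuclideanSpace ℝ (Fin dd) → ℝ)
    (f' : Fin n → EuclideanSpace ℝ (Fin dd) → EuclideanSpace ℝ (Fin dd))
    (hgrad : ∀ i x, HasGradientAt (f i) (f' i x) x)
    (hconv : ∀ i, ConvexOn ℝ Set.univ (f i))
    (hsmooth : ∀ i x y, ‖f' i x - f' i y‖ ≤ L * ‖x - y‖)
    (F : EuclideanSpace ℝ (Fin dd) → ℝ)
    (hF : F = fun x => (n : ℝ)⁻¹ * ∑ i, f i x)
    (Fg : EuclideanSpace ℝ (Fin dd) → EuclideanSpace ℝ (Fin dd))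
    (hFg : Fg = fun x => (n : ℝ)⁻¹ • ∑ i, f' i x)
    (xstar : EuclideanSpace ℝ (Fin dd)) (hmin : ∀ y, F xstar ≤ F y)
    (d : EuclideanSpace ℝ (Fin dd) → ℝ)
    (dg : EuclideanSpace ℝ (Fin dd) → EuclideanSpace ℝ (Fin dd))
    (hdgrad : ∀ x, HasGradientAt d (dg x) x)
    (hdsc : ∀ x y, d y ≥ d x + ⟪dg x, y - x⟫ + (1 / 2) * ‖y - x‖ ^ 2)
    (V : EuclideanSpace ℝ (Fin dd) → EuclideanSpace ℝ (Fin dd) → ℝ)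
    (hV : ∀ x y, V x y = d y - d x - ⟪dg x, y - x⟫)
    (m : ℕ)
    -- the parameter choices (8)
    (α : ℕ → ℝ) (hα : ∀ k, α (k + 1) = ((k : ℝ) + 2) / (4 * L))
    (τ : ℕ → ℝ) (hτ : ∀ k, (τ k)⁻¹ = L * α (k + 1) + 1 / 2)
    (p : ℝ) (hp0 : 0 < p) (hp2 : p ≤ 1 / 2)
    (b : ℕ → ℕ) (hb : ∀ k ≤ m, 1 ≤ b (k + 1) ∧ b (k + 1) ≤ n)
    (δ : ℕ → ℝ) (hδ : ∀ k, δ k = ((n : ℝ) - b k) / (b k * ((n : ℝ) - 1)))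
    (hpb : ∀ k ≤ m, 4 * L * δ (k + 1) * α (k + 1) ≤ p)
    (y0 z0 : EuclideanSpace ℝ (Fin dd))
    -- the iterates, as functions of the sample point
    (x y z v : ((k : Fin (m + 1)) →
        {S : Finset (Fin n) // S ∈ Finset.powersetCard (b (k.1 + 1)) Finset.univ}) →
      ℕ → EuclideanSpace ℝ (Fin dd))
    (hy0 : ∀ ω, y ω 0 = y0) (hz0 : ∀ ω, z ω 0 = z0)
    (hx : ∀ ω, ∀ k ≤ m, x ω (k + 1) = (1 - τ k) • y ω k + τ k • z ω k)
    (hv : ∀ ω, ∀ k, ∀ hk : k ≤ m,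
      v ω (k + 1) = (b (k + 1) : ℝ)⁻¹ •
          (∑ i ∈ (ω ⟨k, Nat.lt_succ_of_le hk⟩ : Finset (Fin n)),
            (f' i (x ω (k + 1)) - f' i y0)) + Fg y0)
    (hy : ∀ ω, ∀ k ≤ m, y ω (k + 1) = x ω (k + 1) - L⁻¹ • v ω (k + 1))
    (hz : ∀ ω, ∀ k ≤ m, dg (z ω (k + 1)) = dg (z ω k) - α (k + 1) • v ω (k + 1))
    -- the expectation over the uniform product measure
    (E : (((k : Fin (m + 1)) →
        {S : Finset (Fin n) // S ∈ Finset.powersetCard (b (k.1 + 1)) Finset.univ}) → ℝ) → ℝ)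
    (hE : ∀ g, E g = (Fintype.card ((k : Fin (m + 1)) →
        {S : Finset (Fin n) // S ∈ Finset.powersetCard (b (k.1 + 1)) Finset.univ}) : ℝ)⁻¹ *
      ∑ ω, g ω)
    -- the additional assumptions of the second bound
    (hgap : F xstar < F y0) (q : ℝ) (hq : 0 < q)
    (hm : 4 * Real.sqrt (L * V z0 xstar / (q * (F y0 - F xstar))) ≤ (m : ℝ)) :
    E (fun ω => F (y ω (m + 1)) - F xstar) ≤
      (q + (5 / 2) * p) * (F y0 - F xstar) := by
  have hn0 : (n : ℝ) ≠ 0 := by positivity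
  have hnpos : (0:ℝ) ≤ (n:ℝ)⁻¹ := by positivity
  have hFx : ∀ x, F x = (n : ℝ)⁻¹ * ∑ i, f i x := fun x => by rw [hF]
  have hFgx : ∀ x, Fg x = (n : ℝ)⁻¹ • ∑ i, f' i x := fun x => by rw [hFg]
  have hFc : ∀ x y, F x + ⟪Fg x, y - x⟫ ≤ F y := by
    intro x y
    have := Finset.sum_le_sum (s := Finset.univ) (fun i _ => grad_ineq (hgrad i) (hconv i) x y)
    rw [Finset.sum_add_distrib, ← sum_inner] at this
    rw [hFx, hFx, hFgx, real_inner_smul_left, ← mul_add]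
    exact mul_le_mul_of_nonneg_left this hnpos
  have hFd : ∀ x y, F y ≤ F x + ⟪Fg x, y - x⟫ + L / 2 * ‖y - x‖ ^ 2 := by
    intro x y
    have := Finset.sum_le_sum (s := Finset.univ) (fun i _ => descent (hgrad i) (hsmooth i) x y)
    rw [Finset.sum_add_distrib, Finset.sum_add_distrib, ← sum_inner, Finset.sum_const,
      Finset.card_univ, Fintype.card_fin, nsmul_eq_mul] at this
    have := mul_le_mul_of_nonneg_left this hnpos
    rw [hFx, hFx, hFgx, real_inner_smul_left]
    refine this.trans (le_of_eq ?_)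
    field_simp
  have hg0 : Fg xstar = 0 := by
    have h1 := hFd xstar (xstar - L⁻¹ • Fg xstar)
    have h2 := hmin (xstar - L⁻¹ • Fg xstar)
    rw [sub_sub_cancel_left, inner_neg_right, real_inner_smul_right, norm_neg, norm_smul, mul_pow,
      Real.norm_eq_abs, sq_abs, real_inner_self_eq_norm_sq] at h1
    have e : L / 2 * (L⁻¹ ^ 2 * ‖Fg xstar‖ ^ 2) = L⁻¹ * ‖Fg xstar‖ ^ 2 / 2 := by field_simp
    have h3 : L⁻¹ * ‖Fg xstar‖ ^ 2 ≤ 0 := by linarith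
    have h4 : 0 < L⁻¹ := by positivity
    have h5 : ‖Fg xstar‖ ^ 2 ≤ 0 := by
      by_contra h
      have := mul_pos h4 (not_le.1 h)
      linarith
    have h6 : ‖Fg xstar‖ = 0 := by
      have := sq_nonneg ‖Fg xstar‖
      exact pow_eq_zero_iff (two_ne_zero) |>.1 (le_antisymm h5 this)
    exact norm_eq_zero.1 h6
  have hco : ∀ x, (n:ℝ)⁻¹ * ∑ i, ‖f' i x - f' i xstar‖ ^ 2 ≤ 2 * L * (F x - F xstar) := by
    intro x
    have := Finset.sum_le_sum (s := Finset.univ)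
      (fun i _ => cocoercive (hgrad i) (hconv i) hL (hsmooth i) xstar x)
    rw [← Finset.mul_sum, Finset.sum_sub_distrib, Finset.sum_sub_distrib, ← sum_inner] at this
    have := mul_le_mul_of_nonneg_left this hnpos
    have e : (n:ℝ)⁻¹ * ⟪∑ i, f' i xstar, x - xstar⟫ = 0 := by
      rw [← real_inner_smul_left, ← hFgx, hg0, inner_zero_left]
    refine this.trans (le_of_eq ?_)
    rw [hFx, hFx]
    linear_combination (- (2 * L)) * e
  have hco2 : ∀ x, (n:ℝ)⁻¹ * ∑ i, ‖f' i x - f' i y0‖ ^ 2 ≤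
      4 * L * (F x - F xstar + (F y0 - F xstar)) := by
    intro x
    have : ∀ i ∈ Finset.univ, ‖f' i x - f' i y0‖ ^ 2 ≤
        2 * ‖f' i x - f' i xstar‖ ^ 2 + 2 * ‖f' i y0 - f' i xstar‖ ^ 2 := by
      intro i _
      have h1 := parallelogram_law_with_norm ℝ (f' i x - f' i xstar) (f' i y0 - f' i xstar)
      rw [sub_sub_sub_cancel_right] at h1
      nlinarith [mul_self_nonneg ‖f' i x - f' i xstar + (f' i y0 - f' i xstar)‖]
    have := Finset.sum_le_sum this
    rw [Finset.sum_add_distrib, ← Finset.mul_sum, ← Finset.mul_sum] at this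
    have := mul_le_mul_of_nonneg_left this hnpos
    have h1 := hco x
    have h2 := hco y0
    linarith
  have hdinj : ∀ u w, dg u = dg w → u = w := by
    intro u w h
    have h1 := hdsc u w
    have h2 := hdsc w u
    rw [h, ← neg_sub u w, inner_neg_right, norm_neg] at h1
    have : ‖u - w‖ ^ 2 ≤ 0 := by linarith
    have h6 : ‖u - w‖ = 0 := pow_eq_zero_iff (two_ne_zero) |>.1 (le_antisymm this (sq_nonneg _))
    exact sub_eq_zero.1 (norm_eq_zero.1 h6)
  -- the iterates do not anticipate
  have hna : ∀ ω ω', ∀ k, k ≤ m + 1 → (∀ j : Fin (m + 1), j.1 < k → ω j = ω' j) →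
      y ω k = y ω' k ∧ z ω k = z ω' k := by
    intro ω ω' k
    induction k with
    | zero => intro _ _; simp [hy0, hz0]
    | succ k ih =>
      intro hk hag
      have hk' : k ≤ m := by omega
      obtain ⟨iy, iz⟩ := ih (by omega) (fun j hj => hag j (by omega))
      have ix : x ω (k + 1) = x ω' (k + 1) := by rw [hx ω k hk', hx ω' k hk', iy, iz]
      have iv : v ω (k + 1) = v ω' (k + 1) := by
        rw [hv ω k hk', hv ω' k hk', ix, hag ⟨k, Nat.lt_succ_of_le hk'⟩ (by simp)]
      refine ⟨by rw [hy ω k hk', hy ω' k hk', ix, iv], hdinj _ _ ?_⟩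
      rw [hz ω k hk', hz ω' k hk', iz, iv]
  have hD0 : 0 < F y0 - F xstar := by linarith
  have hcardA : ∀ k, ∀ inst : Fintype {S : Finset (Fin n) //
      S ∈ Finset.powersetCard (b (k + 1)) (Finset.univ : Finset (Fin n))},
      @Fintype.card _ inst = n.choose (b (k + 1)) := by
    intro k inst
    rw [Fintype.card_of_subtype (Finset.powersetCard (b (k + 1)) Finset.univ) (fun _ => Iff.rfl)]
    simp
  have hstep : ∀ k ≤ m, ∑ ω, (((k:ℝ) + 2) ^ 2 * (F (y ω (k + 1)) - F xstar) +
        16 * L * V (z ω (k + 1)) xstar) ≤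
      ∑ ω, ((((k:ℝ) + 1) ^ 2 - 1) * (F (y ω k) - F xstar) + 16 * L * V (z ω k) xstar
        + 4 * (k + 2) * p * (F y0 - F xstar)) := by
    intro k hk
    obtain ⟨hb1, hbn⟩ := hb k hk
    have hCpos : (0:ℝ) < (n.choose (b (k + 1)) : ℝ) := by exact_mod_cast Nat.choose_pos hbn
    have hc := hcardA k inferInstance
    refine le_of_mul_le_mul_left ?_ hCpos
    have hsu := @sum_update _ _ _ (fun k : Fin (m + 1) =>
        {S : Finset (Fin n) // S ∈ Finset.powersetCard (b (k.1 + 1)) Finset.univ}) _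
      ⟨k, Nat.lt_succ_of_le hk⟩ inferInstance
      (fun ω => ((k:ℝ) + 2) ^ 2 * (F (y ω (k + 1)) - F xstar) +
        16 * L * V (z ω (k + 1)) xstar)
    rw [hcardA k] at hsu
    rw [← hsu, Finset.mul_sum]
    refine Finset.sum_le_sum fun ω _ => ?_
    set u : {S : Finset (Fin n) // S ∈ Finset.powersetCard (b (k + 1)) Finset.univ} → _ :=
      fun s => Function.update ω ⟨k, Nat.lt_succ_of_le hk⟩ s with hu
    have hold : ∀ s, y (u s) k = y ω k ∧ z (u s) k = z ω k := by
      intro s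
      refine hna _ _ k (by omega) fun j hj => ?_
      refine Function.update_of_ne ?_ _ _
      intro h; rw [h] at hj; simp at hj
    have hxs : ∀ s, x (u s) (k + 1) = x ω (k + 1) := by
      intro s
      rw [hx _ k hk, hx _ k hk, (hold s).1, (hold s).2]
    have hvs : ∀ s, v (u s) (k + 1) = (b (k + 1) : ℝ)⁻¹ •
          (∑ i ∈ (s : Finset (Fin n)), (f' i (x ω (k + 1)) - f' i y0)) + Fg y0 := by
      intro s
      rw [hv _ k hk, hxs s]
      simp only [hu, Function.update_self]
    have hFgd : (n:ℝ)⁻¹ • ∑ i, (f' i (x ω (k + 1)) - f' i y0) = Fg (x ω (k + 1)) - Fg y0 := by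
      rw [hFgx, hFgx, Finset.sum_sub_distrib, smul_sub]
    have hα1 : L * α (k + 1) = ((k:ℝ) + 2) / 4 := by rw [hα]; field_simp
    have hk0 : (0:ℝ) ≤ k := by positivity
    have := one_step L (α (k + 1)) (τ k) (δ (k + 1)) p (F y0 - F xstar) hL (hτ k)
      (by rw [hα1]; linarith) hp2 hD0.le (hpb k hk) hFc hFd xstar hmin hdsc hV
      (x ω (k + 1)) (y ω k) (z ω k) (hx ω k hk) (fun s => v (u s) (k + 1))
      (fun s => y (u s) (k + 1)) (fun s => z (u s) (k + 1)) (by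
        have := mean_lem2 hn (b (k + 1)) hb1 (fun i => f' i (x ω (k + 1)) - f' i y0)
        rw [hFgd] at this
        simp only [hvs]
        rw [Finset.sum_add_distrib, this, Finset.sum_const, Finset.card_univ, hc,
          ← Nat.cast_smul_eq_nsmul ℝ, ← smul_add, sub_add_cancel]) (by
        have := var_lem2 hn (b (k + 1)) hb1 hbn (fun i => f' i (x ω (k + 1)) - f' i y0)
        rw [hFgd, ← hδ] at this
        simp only [hvs, add_sub_assoc, hc]
        have hδ0 : 0 ≤ δ (k + 1) := by
          rw [hδ]
          have h1 : (b (k + 1) : ℝ) ≤ n := by exact_mod_cast hbn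
          have h2 : (2:ℝ) ≤ n := by exact_mod_cast hn
          exact div_nonneg (by linarith) (mul_nonneg (by positivity) (by linarith))
        have h3 := mul_le_mul_of_nonneg_left (mul_le_mul_of_nonneg_left (hco2 (x ω (k + 1))) hδ0)
          hCpos.le
        refine le_trans (le_of_eq ?_) ((this.trans h3).trans (le_of_eq (by ring)))
        refine Finset.sum_congr rfl fun s _ => ?_
        congr 2
        abel)
      (fun s => by rw [hy _ k hk, hxs s]) (fun s => by rw [hz _ k hk, (hold s).2])
    rw [hc] at this
    have h16 := mul_le_mul_of_nonneg_left this (by positivity : 0 ≤ 16 * L)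
    rw [Finset.mul_sum] at h16
    have e1 : 16 * L * (L * α (k + 1) ^ 2) = ((k:ℝ) + 2) ^ 2 := by
      have : 16 * L * (L * α (k + 1) ^ 2) = 16 * (L * α (k + 1)) ^ 2 := by ring
      rw [this, hα1]; ring
    refine le_trans (le_of_eq ?_) (h16.trans (le_of_eq ?_))
    · refine Finset.sum_congr (by ext; simp) fun s _ => ?_
      simp only [hu]
      linear_combination (- (F (y (Function.update ω ⟨k, Nat.lt_succ_of_le hk⟩ s) (k + 1)) - F xstar)) * e1
    · linear_combination ((n.choose (b (k + 1)) : ℝ) * (F (y ω k) - F xstar)) * e1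
        + ((n.choose (b (k + 1)) : ℝ) * (-8 * (F (y ω k) - F xstar) + 16 * p * (F y0 - F xstar))) * hα1
  set C : ℝ := (Fintype.card ((k : Fin (m + 1)) →
        {S : Finset (Fin n) // S ∈ Finset.powersetCard (b (k.1 + 1)) Finset.univ}) : ℝ) with hC
  have hCi : ∀ inst : Fintype ((k : Fin (m + 1)) →
        {S : Finset (Fin n) // S ∈ Finset.powersetCard (b (k.1 + 1)) Finset.univ}),
        (@Fintype.card _ inst : ℝ) = C := by
    intro inst
    exact congrArg (fun i => (@Fintype.card _ i : ℝ)) (Subsingleton.elim inst _)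
  have hCpos : 0 < C := by
    have hne : ∀ k : Fin (m + 1), Nonempty
        {S : Finset (Fin n) // S ∈ Finset.powersetCard (b (k.1 + 1)) Finset.univ} := by
      intro k
      rw [← Fintype.card_pos_iff, hcardA]
      exact Nat.choose_pos (hb k.1 (Nat.lt_succ_iff.1 k.2)).2
    rw [← hCi inferInstance]
    exact Nat.cast_pos.2 Fintype.card_pos
  have htel : ∀ k ≤ m, ∑ ω, (((k:ℝ) + 2) ^ 2 * (F (y ω (k + 1)) - F xstar) +
        16 * L * V (z ω (k + 1)) xstar) ≤
      C * (16 * L * V z0 xstar + 2 * p * (k + 1) * (k + 4) * (F y0 - F xstar)) := by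
    intro k
    induction k with
    | zero =>
      intro h0
      refine (hstep 0 h0).trans (le_of_eq ?_)
      simp only [hy0, hz0, Finset.sum_const, Finset.card_univ, nsmul_eq_mul, hCi]
      push_cast; ring
    | succ k ih =>
      intro hk
      have h1 := ih (by omega)
      have h2 := hstep (k + 1) hk
      refine h2.trans ?_
      have h3 : ∑ ω, ((((((k + 1 : ℕ):ℝ) + 1) ^ 2 - 1) * (F (y ω (k + 1)) - F xstar) + 16 * L * V (z ω (k + 1)) xstar
        + 4 * (((k + 1 : ℕ):ℝ) + 2) * p * (F y0 - F xstar))) ≤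
          ∑ ω, ((((k:ℝ) + 2) ^ 2 * (F (y ω (k + 1)) - F xstar) +
        16 * L * V (z ω (k + 1)) xstar) + 4 * (((k + 1 : ℕ):ℝ) + 2) * p * (F y0 - F xstar)) := by
        refine Finset.sum_le_sum fun ω _ => ?_
        have := hmin (y ω (k + 1))
        push_cast
        linarith
      refine h3.trans ?_
      rw [Finset.sum_add_distrib, Finset.sum_const, Finset.card_univ, nsmul_eq_mul, hCi]
      push_cast
      linarith
  have hVnn : ∀ u, 0 ≤ V u xstar := by
    intro u
    have := hdsc u xstar
    rw [hV]
    have : 0 ≤ ‖xstar - u‖ ^ 2 := by positivity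
    linarith
  have hfin := htel m le_rfl
  refine final_arith hL hp0 hq hD0 (hVnn z0) hm ?_
  have hdrop : ((m:ℝ) + 2) ^ 2 * ∑ ω, (F (y ω (m + 1)) - F xstar) ≤
      ∑ ω, (((m:ℝ) + 2) ^ 2 * (F (y ω (m + 1)) - F xstar) + 16 * L * V (z ω (m + 1)) xstar) := by
    rw [Finset.mul_sum]
    refine Finset.sum_le_sum fun ω _ => ?_
    have := mul_nonneg (by positivity : 0 ≤ 16 * L) (hVnn (z ω (m + 1)))
    linarith
  have hE2 : E (fun ω => F (y ω (m + 1)) - F xstar) = C⁻¹ * ∑ ω, (F (y ω (m + 1)) - F xstar) := by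
    refine (hE _).trans (congrArg _ (Finset.sum_congr ?_ fun _ _ => rfl))
    ext; simp
  rw [hE2]
  have h5 := mul_le_mul_of_nonneg_left (hdrop.trans hfin) (inv_nonneg.2 hCpos.le)
  rw [← mul_assoc C⁻¹ C, inv_mul_cancel₀ hCpos.ne', one_mul] at h5
  linarith
end
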